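/- (Rivoal) At least one of the nine numbers ζ(5), ζ(7), ζ(9), ζ(11), ζ(13), ζ(15), ζ(17), ζ(19), ζ(21) is irrational. -/

import Mathlib

/-- The values of the Riemann zeta function at integers `s ≥ 2`,
as a real number: `ζ(s) = ∑_{n ≥ 1} n^{-s}`. -/
noncomputable def zetaR (s : ℕ) : ℝ := ∑' n : ℕ, 1 / (n + 1 : ℝ) ^ s

section

open MeasureTheory Filter Topology Set

/-- The Fejér kernel `2 (1 - cos v) / v ^ 2`. -/
noncomputable def fejerKernel (v : ℝ) : ℝ := 2 * (1 - Real.cos v) / v ^ 2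

lemma fejerKernel_nonneg (v : ℝ) : 0 ≤ fejerKernel v := by
  unfold fejerKernel
  have := Real.cos_le_one v
  apply div_nonneg <;> nlinarith [sq_nonneg v]

lemma fejerKernel_le (v : ℝ) : fejerKernel v ≤ 5 * (1 + v ^ 2)⁻¹ := by
  unfold fejerKernel
  rcases eq_or_ne v 0 with rfl | hv
  · simp
  have h1 := Real.one_sub_sq_div_two_le_cos (x := v)
  have h2 := Real.neg_one_le_cos v
  have hv2 : 0 < v ^ 2 := by positivity
  rw [← div_eq_mul_inv, div_le_div_iff₀ hv2 (by positivity)]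
  nlinarith

lemma measurable_fejerKernel : Measurable fejerKernel := by
  unfold fejerKernel
  fun_prop

lemma integrable_fejerKernel : Integrable fejerKernel := by
  refine (integrable_inv_one_add_sq.const_mul 5).mono'
    measurable_fejerKernel.aestronglyMeasurable (Eventually.of_forall fun v => ?_)
  rw [Real.norm_of_nonneg (fejerKernel_nonneg v)]
  exact fejerKernel_le v

lemma integral_fejerKernel_pos : 0 < ∫ v, fejerKernel v := by
  rw [integral_pos_iff_support_of_nonneg fejerKernel_nonneg integrable_fejerKernel]
  refine lt_of_lt_of_le ?_ (measure_mono (s := Ioo (0 : ℝ) 1) ?_)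
  · simp
  · intro v hv
    have h : Real.cos v < 1 := by
      have := Real.cos_lt_cos_of_nonneg_of_le_pi le_rfl (by linarith [hv.2, Real.pi_gt_three]) hv.1
      simpa using this
    have : 0 < v ^ 2 := by have := hv.1; positivity
    have h3 : 0 < 2 * (1 - Real.cos v) := by linarith
    exact (div_pos h3 this).ne'

lemma integral_triangle_mul_cexp {v : ℝ} (hv : v ≠ 0) :
    ∫ t in Ioc (-1 : ℝ) 1, ((1 - |t| : ℝ) : ℂ) * Complex.exp (t * v * Complex.I)
      = fejerKernel v := by
  have hc : Continuous fun t : ℝ => ((1 - |t| : ℝ) : ℂ) * Complex.exp (t * v * Complex.I) := by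
    fun_prop
  rw [← intervalIntegral.integral_of_le (by norm_num),
    ← intervalIntegral.integral_add_adjacent_intervals (b := 0)
      (hc.intervalIntegrable _ _) (hc.intervalIntegrable _ _)]
  have h1 := intervalIntegral.integral_comp_neg (a := 0) (b := 1)
    (fun t : ℝ => ((1 - |t| : ℝ) : ℂ) * Complex.exp (t * v * Complex.I))
  rw [neg_zero] at h1
  rw [← h1, ← intervalIntegral.integral_add ((by fun_prop : Continuous _).intervalIntegrable _ _)
    (hc.intervalIntegrable _ _)]
  have h2 : ∫ t in (0 : ℝ)..1, (1 - t) * (2 * Real.cos (t * v)) = fejerKernel v := by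
    have hd : ∀ t ∈ uIcc (0 : ℝ) 1, HasDerivAt
        (fun t => 2 * ((1 - t) * Real.sin (t * v) / v - Real.cos (t * v) / v ^ 2))
        ((1 - t) * (2 * Real.cos (t * v))) t := by
      intro t _
      have e1 : HasDerivAt (fun t : ℝ => t * v) v t := by
        simpa using (hasDerivAt_id t).mul_const v
      have e2 := ((hasDerivAt_id t).const_sub 1).mul e1.sin
      have e3 := ((e2.div_const v).sub (e1.cos.div_const (v ^ 2))).const_mul 2
      refine e3.congr_deriv ?_
      simp only [id]
      field_simp
      ring
    rw [intervalIntegral.integral_eq_sub_of_hasDerivAt hd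
      ((by fun_prop : Continuous _).intervalIntegrable _ _)]
    simp [fejerKernel]
    ring
  rw [← h2, ← intervalIntegral.integral_ofReal]
  apply intervalIntegral.integral_congr
  intro t ht
  rw [uIcc_of_le (by norm_num)] at ht
  simp only [abs_neg, abs_of_nonneg ht.1, Complex.ofReal_mul, Complex.ofReal_cos,
    Complex.ofReal_ofNat, Complex.ofReal_neg, Complex.two_cos]
  rw [← mul_add, add_comm]
  simp

lemma fejer_smoothing {f : ℝ → ℝ} {M : ℝ} (hf : Measurable f) (hM : ∀ u, |f u| ≤ M)
    (h0 : ∀ u ≤ 0, f u = 0) {G : ℂ → ℂ} 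
    (hL : ∀ s : ℂ, 0 < s.re → ∫ u, (f u : ℂ) * Complex.exp (-s * u) = G s)
    {ε : ℝ} (hε : 0 < ε) (y : ℝ) :
    ((∫ u, f u * Real.exp (-ε * u) * fejerKernel (y - u) : ℝ) : ℂ) =
      ∫ t in Ioc (-1 : ℝ) 1, ((1 - |t| : ℝ) : ℂ) * Complex.exp (t * y * Complex.I) *
        G (ε + t * Complex.I) := by
  have hInt : Integrable fun u => f u * Real.exp (-ε * u) := by
    have h1 : IntegrableOn (fun u => f u * Real.exp (-ε * u)) (Ioi 0) := by
      refine ((integrableOn_exp_mul_Ioi (a := -ε) (by linarith) 0).const_mul M).mono'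
        (by fun_prop) (Eventually.of_forall fun u => ?_)
      rw [norm_mul, Real.norm_eq_abs, Real.norm_of_nonneg (Real.exp_pos _).le]
      exact mul_le_mul_of_nonneg_right (hM u) (Real.exp_pos _).le
    rw [← integrable_indicator_iff measurableSet_Ioi] at h1
    refine h1.congr (Eventually.of_forall fun u => ?_)
    by_cases hu : 0 < u
    · simp [hu]
    · simp [hu, h0 u (not_lt.1 hu)]
  have hk : Integrable (fun t : ℝ => ((1 - |t| : ℝ) : ℂ)) (volume.restrict (Ioc (-1) 1)) :=
    (by fun_prop : Continuous fun t : ℝ => ((1 - |t| : ℝ) : ℂ)).integrableOn_Ioc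
  have hInt' : Integrable (fun u => ((f u * Real.exp (-ε * u) : ℝ) : ℂ)) := hInt.ofReal
  have hprod := hInt'.mul_prod hk
  have hswap : Integrable (Function.uncurry fun u t : ℝ =>
      ((f u * Real.exp (-ε * u) : ℝ) : ℂ) * (((1 - |t| : ℝ) : ℂ) *
        Complex.exp (t * (y - u : ℝ) * Complex.I)))
      (volume.prod (volume.restrict (Ioc (-1) 1))) := by
    have := hprod.bdd_mul (c := 1)
      (f := fun z : ℝ × ℝ => Complex.exp (z.2 * (y - z.1 : ℝ) * Complex.I))
      (by fun_prop) (Eventually.of_forall fun z => ?_)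
    · refine this.congr (Eventually.of_forall fun z => ?_)
      simp only [Function.uncurry]
      push_cast
      ring
    · have := Complex.norm_exp_ofReal_mul_I (z.2 * (y - z.1))
      push_cast at this ⊢
      exact this.le
  have hsw := integral_integral_swap hswap
  rw [← integral_complex_ofReal]
  calc _ = ∫ u, ∫ t in Ioc (-1 : ℝ) 1, ((f u * Real.exp (-ε * u) : ℝ) : ℂ) *
        (((1 - |t| : ℝ) : ℂ) * Complex.exp (t * (y - u : ℝ) * Complex.I)) := by
        refine integral_congr_ae ?_
        have : ∀ᵐ u : ℝ, u ≠ y := by simp [ae_iff]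
        filter_upwards [this] with u hu
        rw [integral_const_mul, integral_triangle_mul_cexp (sub_ne_zero.2 hu.symm)]
        push_cast
        ring
    _ = _ := by
        rw [hsw]
        refine integral_congr_ae (Eventually.of_forall fun t => ?_)
        simp only
        rw [← hL _ (by simp [hε]), ← integral_const_mul]
        refine integral_congr_ae (Eventually.of_forall fun u => ?_)
        simp only
        have : Complex.exp (t * (y - u : ℝ) * Complex.I) * Complex.exp (-ε * u) =
            Complex.exp (t * y * Complex.I) * Complex.exp (-(ε + t * Complex.I) * u) := by
          rw [← Complex.exp_add, ← Complex.exp_add]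
          push_cast
          ring_nf
        push_cast at this ⊢
        linear_combination (f u * (1 - |t| : ℂ)) * this

lemma tendsto_fejer_smoothing {f : ℝ → ℝ} {M : ℝ} (hf : Measurable f) (hM : ∀ u, |f u| ≤ M)
    (h0 : ∀ u ≤ 0, f u = 0) {G : ℂ → ℂ} (hG : ContinuousOn G {s | 0 ≤ s.re})
    (hL : ∀ s : ℂ, 0 < s.re → ∫ u, (f u : ℂ) * Complex.exp (-s * u) = G s) :
    Tendsto (fun y => ∫ u, f u * fejerKernel (y - u)) atTop (𝓝 0) := by
  have hM0 : 0 ≤ M := (abs_nonneg _).trans (hM 0)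
  have key : ∀ y : ℝ, ((∫ u, f u * fejerKernel (y - u) : ℝ) : ℂ) =
      ∫ t in Ioc (-1 : ℝ) 1, ((1 - |t| : ℝ) : ℂ) * Complex.exp (t * y * Complex.I) *
        G (t * Complex.I) := by
    intro y
    have hl : Tendsto (fun ε : ℝ => ∫ u, f u * Real.exp (-ε * u) * fejerKernel (y - u)) (𝓝[>] 0)
        (𝓝 (∫ u, f u * fejerKernel (y - u))) := by
      refine tendsto_integral_filter_of_dominated_convergence
        (fun u => M * fejerKernel (y - u)) ?_ ?_ ?_ ?_
      · refine Eventually.of_forall fun ε => Measurable.aestronglyMeasurable ?_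
        have := measurable_fejerKernel
        fun_prop
      · filter_upwards [self_mem_nhdsWithin] with ε hε
        refine Eventually.of_forall fun u => ?_
        rw [norm_mul, norm_mul, Real.norm_of_nonneg (fejerKernel_nonneg _), Real.norm_eq_abs,
          Real.norm_of_nonneg (Real.exp_pos _).le]
        refine mul_le_mul_of_nonneg_right ?_ (fejerKernel_nonneg _)
        rcases le_or_gt u 0 with hu | hu
        · simpa [h0 u hu] using hM0
        · have : Real.exp (-ε * u) ≤ 1 := by
            rw [Real.exp_le_one_iff]
            have : (0 : ℝ) < ε := hε
            nlinarith
          calc _ ≤ M * 1 := mul_le_mul (hM u) this (Real.exp_pos _).le hM0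
            _ = M := mul_one M
      · exact (integrable_fejerKernel.comp_sub_left y).const_mul M
      · refine Eventually.of_forall fun u => ?_
        have : Continuous fun ε : ℝ => f u * Real.exp (-ε * u) * fejerKernel (y - u) := by fun_prop
        simpa using (this.tendsto 0).mono_left nhdsWithin_le_nhds
    have hcomp : IsCompact ((fun p : ℝ × ℝ => (p.1 + p.2 * Complex.I : ℂ)) ''
        (Icc 0 1 ×ˢ Icc (-1) 1)) :=
      (isCompact_Icc.prod isCompact_Icc).image (by fun_prop)
    obtain ⟨A, hA⟩ := hcomp.exists_bound_of_continuousOn (hG.mono (by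
      rintro _ ⟨p, hp, rfl⟩
      simpa using hp.1.1))
    have hr : Tendsto (fun ε : ℝ => ∫ t in Ioc (-1 : ℝ) 1,
        ((1 - |t| : ℝ) : ℂ) * Complex.exp (t * y * Complex.I) * G (ε + t * Complex.I)) (𝓝[>] 0)
        (𝓝 (∫ t in Ioc (-1 : ℝ) 1,
        ((1 - |t| : ℝ) : ℂ) * Complex.exp (t * y * Complex.I) * G (t * Complex.I))) := by
      refine tendsto_integral_filter_of_dominated_convergence (fun _ => A) ?_ ?_ ?_ ?_
      · filter_upwards [self_mem_nhdsWithin] with ε hε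
        have : Continuous fun t : ℝ => G (ε + t * Complex.I) := by
          refine hG.comp_continuous (by fun_prop) fun t => ?_
          have : (0 : ℝ) < ε := hε
          simpa using this.le
        exact (Continuous.mul (by fun_prop) this).aestronglyMeasurable
      · filter_upwards [Ioc_mem_nhdsGT (zero_lt_one' ℝ)] with ε hε
        filter_upwards [ae_restrict_mem measurableSet_Ioc] with t ht
        have h1 := hA (ε + t * Complex.I) ⟨(ε, t), ⟨⟨hε.1.le, hε.2⟩, ht.1.le, ht.2⟩, rfl⟩
        have h2 : ‖Complex.exp (t * y * Complex.I)‖ = 1 := by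
          simpa using Complex.norm_exp_ofReal_mul_I (t * y)
        rw [norm_mul, norm_mul, h2, mul_one, Complex.norm_real, Real.norm_eq_abs]
        have h3 : |t| ≤ 1 := abs_le.2 ⟨ht.1.le, ht.2⟩
        have h4 : abs (1 - |t|) ≤ 1 := abs_le.2 ⟨by linarith, by linarith [abs_nonneg t]⟩
        calc _ ≤ 1 * A := mul_le_mul h4 h1 (norm_nonneg _) zero_le_one
          _ = A := one_mul A
      · exact integrable_const A
      · refine Eventually.of_forall fun t => Tendsto.const_mul _ ?_
        have h1 : Tendsto (fun ε : ℝ => (ε + t * Complex.I : ℂ)) (𝓝[>] 0)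
            (𝓝[{s | 0 ≤ s.re}] (t * Complex.I)) := by
          refine tendsto_nhdsWithin_iff.2 ⟨?_, ?_⟩
          · have : Continuous fun ε : ℝ => (ε + t * Complex.I : ℂ) := by fun_prop
            simpa using (this.tendsto 0).mono_left nhdsWithin_le_nhds
          · filter_upwards [self_mem_nhdsWithin] with ε hε
            have : (0 : ℝ) < ε := hε
            simpa using this.le
        exact (hG (t * Complex.I) (by simp)).tendsto.comp h1
    refine tendsto_nhds_unique ((Complex.continuous_ofReal.tendsto _).comp hl) (hr.congr' ?_)
    filter_upwards [self_mem_nhdsWithin] with ε hε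
    exact (fejer_smoothing hf hM h0 hL hε y).symm
  have hRL := (Real.tendsto_integral_exp_smul_cocompact
    ((Ioc (-1 : ℝ) 1).indicator fun t : ℝ => ((1 - |t| : ℝ) : ℂ) * G (t * Complex.I))).comp
    (show Tendsto (fun y : ℝ => -(2 * Real.pi)⁻¹ * y) atTop (cocompact ℝ) from
      (Tendsto.const_mul_atTop_of_neg (by simp [Real.pi_pos]) tendsto_id).mono_right
        atBot_le_cocompact)
  have : Tendsto (fun y => ((∫ u, f u * fejerKernel (y - u) : ℝ) : ℂ)) atTop (𝓝 0) := by
    refine hRL.congr fun y => ?_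
    rw [key, ← integral_indicator measurableSet_Ioc]
    simp only [Function.comp]
    refine integral_congr_ae (Eventually.of_forall fun t => ?_)
    by_cases ht : t ∈ Ioc (-1 : ℝ) 1
    · simp only [indicator_of_mem ht, Circle.smul_def, Real.fourierChar_apply, smul_eq_mul]
      have : (2 * Real.pi * -(t * (-(2 * Real.pi)⁻¹ * y)) : ℝ) = t * y := by
        field_simp
      rw [this]
      push_cast
      ring
    · simp [indicator_of_notMem ht]
  have h2 := (Complex.continuous_re.tendsto _).comp this
  simpa [Function.comp_def] using h2

end

section

open MeasureTheory Filter Topology Set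

lemma tendsto_integral_Ioo_fejerKernel :
    Tendsto (fun a : ℝ => ∫ v in Icc (-a) a, fejerKernel v) atTop (𝓝 (∫ v, fejerKernel v)) := by
  have h := intervalIntegral_tendsto_integral integrable_fejerKernel tendsto_neg_atTop_atBot
    tendsto_id
  refine h.congr' ?_
  filter_upwards [eventually_ge_atTop 0] with a ha
  rw [intervalIntegral.integral_of_le (by simp only [id]; linarith), integral_Icc_eq_integral_Ioc]
  rfl

section Tauberian

variable {B : ℝ → ℝ} {M : ℝ} {G : ℂ → ℂ}

lemma tendsto_fejer_average (hB : Measurable B) (h0 : ∀ u, 0 ≤ B u) (hM : ∀ u, B u ≤ M)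
    (hneg : ∀ u ≤ 0, B u = 0) (hG : ContinuousOn G {s | 0 ≤ s.re})
    (hL : ∀ s : ℂ, 0 < s.re →
      ∫ u, ((B u - (Ioi 0).indicator 1 u : ℝ) : ℂ) * Complex.exp (-s * u) = G s)
    {r : ℝ} (hr : 0 < r) :
    Tendsto (fun y => ∫ v, B ((y - v) / r) * fejerKernel v) atTop (𝓝 (∫ v, fejerKernel v)) := by
  have hm := measurable_fejerKernel
  have hi := integrable_fejerKernel
  have hM0 : 0 ≤ M := (h0 0).trans (hM 0)
  have h1 : Tendsto (fun y => ∫ u, (B (u / r) - (Ioi 0).indicator 1 u) * fejerKernel (y - u))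
      atTop (𝓝 0) := by
    refine tendsto_fejer_smoothing (M := M + 1) (G := fun s => r * G (r * s)) ?_ ?_ ?_ ?_ ?_
    · exact (hB.comp (measurable_id.div_const r)).sub
        (measurable_one.indicator measurableSet_Ioi)
    · intro u
      have := h0 (u / r)
      have := hM (u / r)
      by_cases hu : 0 < u
      · simp only [mem_Ioi, hu, indicator_of_mem, Pi.one_apply]
        rw [abs_le]; constructor <;> linarith
      · simp only [mem_Ioi, hu, not_false_eq_true, indicator_of_notMem, sub_zero]
        rw [abs_le]; constructor <;> linarith
    · intro u hu
      have : u / r ≤ 0 := div_nonpos_of_nonpos_of_nonneg hu hr.le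
      simp [hneg _ this, hu]
    · refine ContinuousOn.const_mul ?_ _
      refine hG.comp (by fun_prop) fun s hs => ?_
      simp only [mem_ofPred_eq, Complex.mul_re, Complex.ofReal_re, Complex.ofReal_im, zero_mul,
        sub_zero] at hs ⊢
      positivity
    · intro s hs
      rw [← hL (r * s) (by simpa using mul_pos hr hs)]
      have := Measure.integral_comp_div (fun u => ((B u - (Ioi 0).indicator 1 u : ℝ) : ℂ) *
        Complex.exp (-(r * s) * u)) r
      rw [abs_of_pos hr, Complex.real_smul] at this
      rw [← this]
      refine integral_congr_ae (Eventually.of_forall fun u => ?_)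
      have hr' : (r : ℂ) ≠ 0 := by exact_mod_cast hr.ne'
      have e1 : (Ioi (0 : ℝ)).indicator (1 : ℝ → ℝ) (u / r) = (Ioi (0 : ℝ)).indicator 1 u := by
        have : 0 < u / r ↔ 0 < u := div_pos_iff_of_pos_right hr
        simp [indicator, this]
      simp only [e1]
      congr 2
      push_cast
      field_simp
  have h2 : Tendsto (fun y : ℝ => ∫ u, (Ioi (0 : ℝ)).indicator (1 : ℝ → ℝ) u * fejerKernel (y - u))
      atTop (𝓝 (∫ v, fejerKernel v)) := by
    have h3 := tendsto_setIntegral_of_monotone (s := fun y : ℝ => Iio y) (f := fejerKernel)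
      (μ := volume) (fun _ => measurableSet_Iio) (fun a b hab => Iio_subset_Iio hab)
      hi.integrableOn
    rw [iUnion_Iio, setIntegral_univ] at h3
    refine h3.congr fun y => ?_
    rw [← integral_sub_left_eq_self _ volume y, ← integral_indicator measurableSet_Iio]
    refine integral_congr_ae (Eventually.of_forall fun u => ?_)
    by_cases hu : 0 < u <;> simp [indicator]
  have h3 := h1.add h2
  rw [zero_add] at h3
  refine h3.congr fun y => ?_
  have i1 : Integrable fun u => B (u / r) * fejerKernel (y - u) := by
    refine (hi.comp_sub_left y).bdd_mul (c := M)
      (hB.comp (measurable_id.div_const r)).aestronglyMeasurable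
      (Eventually.of_forall fun u => ?_)
    rw [Real.norm_of_nonneg (h0 _)]
    exact hM _
  have i2 : Integrable fun u => (Ioi (0 : ℝ)).indicator (1 : ℝ → ℝ) u * fejerKernel (y - u) := by
    refine (hi.comp_sub_left y).bdd_mul (c := 1)
      (measurable_one.indicator measurableSet_Ioi).aestronglyMeasurable
      (Eventually.of_forall fun u => ?_)
    by_cases hu : 0 < u <;> simp [indicator, hu]
  rw [← integral_add ((i1.sub i2).congr (Eventually.of_forall fun u => (sub_mul _ _ _).symm)) i2,
    ← integral_sub_left_eq_self _ volume y]
  refine integral_congr_ae (Eventually.of_forall fun u => ?_)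
  simp only [sub_sub_cancel]
  ring

lemma le_fejer_average (hB : Measurable B) (h0 : ∀ u, 0 ≤ B u) (hM : ∀ u, B u ≤ M)
    (hmono : ∀ u s, 0 ≤ s → B u * Real.exp (-s) ≤ B (u + s)) {d r : ℝ} (hr : 0 < r)
    (x : ℝ) :
    B x * Real.exp (-(2 * d)) * ∫ v in Icc (-(r * d)) (r * d), fejerKernel v ≤
      ∫ v, B ((r * x + r * d - v) / r) * fejerKernel v := by
  have hi := integrable_fejerKernel
  have i1 : Integrable fun v => B ((r * x + r * d - v) / r) * fejerKernel v := by
    refine hi.bdd_mul (c := M) (hB.comp (by fun_prop)).aestronglyMeasurable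
      (Eventually.of_forall fun u => ?_)
    rw [Real.norm_of_nonneg (h0 _)]
    exact hM _
  rw [← integral_const_mul]
  refine (setIntegral_mono_on (hi.const_mul _).integrableOn i1.integrableOn measurableSet_Icc
    fun v hv => ?_).trans (setIntegral_le_integral i1 (Eventually.of_forall fun v =>
      mul_nonneg (h0 _) (fejerKernel_nonneg _)))
  refine mul_le_mul_of_nonneg_right ?_ (fejerKernel_nonneg v)
  have h1 : (r * x + r * d - v) / r = x + (r * d - v) / r := by field_simp; ring
  have h2 : 0 ≤ (r * d - v) / r := div_nonneg (by linarith [hv.2]) hr.le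
  have h3 : (r * d - v) / r ≤ 2 * d := by rw [div_le_iff₀ hr]; linarith [hv.1]
  rw [h1]
  refine le_trans (mul_le_mul_of_nonneg_left ?_ (h0 x)) (hmono x _ h2)
  exact Real.exp_le_exp.2 (by linarith)

lemma fejer_average_le (hB : Measurable B) (h0 : ∀ u, 0 ≤ B u) (hM : ∀ u, B u ≤ M)
    (hmono : ∀ u s, 0 ≤ s → B u * Real.exp (-s) ≤ B (u + s)) {d r : ℝ} (hr : 0 < r)
    (x : ℝ) :
    ∫ v, B ((r * x - r * d - v) / r) * fejerKernel v ≤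
      B x * Real.exp (2 * d) * (∫ v, fejerKernel v) + 
      M * ((∫ v, fejerKernel v) - ∫ v in Icc (-(r * d)) (r * d), fejerKernel v) := by
  have hi := integrable_fejerKernel
  have i1 : Integrable fun v => B ((r * x - r * d - v) / r) * fejerKernel v := by
    refine hi.bdd_mul (c := M) (hB.comp (by fun_prop)).aestronglyMeasurable
      (Eventually.of_forall fun u => ?_)
    rw [Real.norm_of_nonneg (h0 _)]
    exact hM _
  rw [← integral_add_compl (measurableSet_Icc (a := -(r * d)) (b := r * d)) i1,
    ← integral_add_compl (measurableSet_Icc (a := -(r * d)) (b := r * d)) hi, add_sub_cancel_left]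
  refine add_le_add ?_ ?_
  · refine (?_ : _ ≤ ∫ v in Icc (-(r * d)) (r * d), B x * Real.exp (2 * d) * fejerKernel v).trans ?_
    · refine setIntegral_mono_on i1.integrableOn (hi.const_mul _).integrableOn measurableSet_Icc
        fun v hv => mul_le_mul_of_nonneg_right ?_ (fejerKernel_nonneg v)
      have h1 : x = (r * x - r * d - v) / r + (r * d + v) / r := by field_simp; ring
      have h2 : 0 ≤ (r * d + v) / r := div_nonneg (by linarith [hv.1]) hr.le
      have h3 : (r * d + v) / r ≤ 2 * d := by rw [div_le_iff₀ hr]; linarith [hv.2]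
      have h4 := hmono ((r * x - r * d - v) / r) _ h2
      rw [← h1] at h4
      calc B ((r * x - r * d - v) / r) = B ((r * x - r * d - v) / r) * 
            Real.exp (-((r * d + v) / r)) * Real.exp ((r * d + v) / r) := by
            rw [mul_assoc, ← Real.exp_add]; simp
        _ ≤ B x * Real.exp (2 * d) := 
            mul_le_mul h4 (Real.exp_le_exp.2 h3) (Real.exp_pos _).le (h0 _)
    · rw [integral_const_mul]
      refine mul_le_mul_of_nonneg_left ?_ (mul_nonneg (h0 _) (Real.exp_pos _).le)
      exact le_add_of_nonneg_right (integral_nonneg fejerKernel_nonneg)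
  · rw [← integral_const_mul]
    refine setIntegral_mono_on i1.integrableOn (hi.const_mul _).integrableOn
      measurableSet_Icc.compl fun v _ => mul_le_mul_of_nonneg_right (hM _) (fejerKernel_nonneg v)

/-- A Tauberian theorem of Wiener–Ikehara type for slowly decreasing bounded functions. -/
theorem tendsto_one_of_laplace_continuousOn (hB : Measurable B) (h0 : ∀ u, 0 ≤ B u)
    (hM : ∀ u, B u ≤ M) (hneg : ∀ u ≤ 0, B u = 0)
    (hmono : ∀ u s, 0 ≤ s → B u * Real.exp (-s) ≤ B (u + s))
    (hG : ContinuousOn G {s | 0 ≤ s.re})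
    (hL : ∀ s : ℂ, 0 < s.re →
      ∫ u, ((B u - (Ioi 0).indicator 1 u : ℝ) : ℂ) * Complex.exp (-s * u) = G s) :
    Tendsto B atTop (𝓝 1) := by
  have hk := integral_fejerKernel_pos
  have hav := fun r (hr : 0 < r) => tendsto_fejer_average hB h0 hM hneg hG hL hr
  set κ := ∫ v, fejerKernel v
  have hlim : ∀ d > 0, Tendsto (fun r : ℝ => ∫ v in Icc (-(r * d)) (r * d), fejerKernel v) atTop
      (𝓝 κ) := fun d hd => tendsto_integral_Ioo_fejerKernel.comp (tendsto_id.atTop_mul_const hd)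
  have hshift : ∀ r e : ℝ, 0 < r → Tendsto (fun x : ℝ => r * x + e) atTop atTop := fun r e hr =>
    tendsto_atTop_add_const_right _ _ (tendsto_id.const_mul_atTop hr)
  rw [tendsto_order]
  constructor
  · intro c hc
    have : ∃ d > 0, c * Real.exp (2 * d) < 1 := by
      have h1 : Tendsto (fun d => c * Real.exp (2 * d)) (𝓝[>] 0) (𝓝 c) := by
        have : Continuous fun d => c * Real.exp (2 * d) := by fun_prop
        simpa using (this.tendsto 0).mono_left nhdsWithin_le_nhds
      obtain ⟨d, hd, hd'⟩ := ((h1.eventually_lt_const hc).and self_mem_nhdsWithin).exists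
      exact ⟨d, hd', hd⟩
    obtain ⟨d, hd, hcd⟩ := this
    have h2 : Tendsto (fun r : ℝ => c * Real.exp (2 * d) * κ +
        M * (κ - ∫ v in Icc (-(r * d)) (r * d), fejerKernel v)) atTop
        (𝓝 (c * Real.exp (2 * d) * κ + M * (κ - κ))) :=
      tendsto_const_nhds.add (((hlim d hd).const_sub κ).const_mul M)
    have h3 : c * Real.exp (2 * d) * κ + M * (κ - κ) < κ := by
      rw [sub_self, mul_zero, add_zero]
      exact mul_lt_of_lt_one_left hk hcd
    obtain ⟨r, hr, hr0⟩ := ((h2.eventually_lt_const h3).and (eventually_gt_atTop 0)).exists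
    filter_upwards [((hav r hr0).comp (hshift r (-(r * d)) hr0)).eventually_const_lt hr] with x hx
    have h4 := fejer_average_le hB h0 hM hmono (d := d) hr0 x
    simp only [Function.comp, ← sub_eq_add_neg] at hx
    have h5 : c * (Real.exp (2 * d) * κ) < B x * (Real.exp (2 * d) * κ) := by linarith
    exact lt_of_mul_lt_mul_right h5 (by positivity)
  · intro c hc
    have : ∃ d > 0, 1 < c * Real.exp (-(2 * d)) := by
      have h1 : Tendsto (fun d => c * Real.exp (-(2 * d))) (𝓝[>] 0) (𝓝 c) := by
        have : Continuous fun d => c * Real.exp (-(2 * d)) := by fun_prop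
        simpa using (this.tendsto 0).mono_left nhdsWithin_le_nhds
      obtain ⟨d, hd, hd'⟩ := ((h1.eventually_const_lt hc).and self_mem_nhdsWithin).exists
      exact ⟨d, hd', hd⟩
    obtain ⟨d, hd, hcd⟩ := this
    have h2 : Tendsto (fun r : ℝ => c * Real.exp (-(2 * d)) *
        ∫ v in Icc (-(r * d)) (r * d), fejerKernel v) atTop
        (𝓝 (c * Real.exp (-(2 * d)) * κ)) := (hlim d hd).const_mul _
    have h3 : κ < c * Real.exp (-(2 * d)) * κ := lt_mul_of_one_lt_left hk hcd
    obtain ⟨r, hr, hr0⟩ := ((h2.eventually_const_lt h3).and (eventually_gt_atTop 0)).exists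
    filter_upwards [((hav r hr0).comp (hshift r (r * d) hr0)).eventually_lt_const hr] with x hx
    have h4 := le_fejer_average hB h0 hM hmono (d := d) hr0 x
    simp only [Function.comp] at hx
    have h6 : 0 ≤ ∫ v in Icc (-(r * d)) (r * d), fejerKernel v := integral_nonneg fejerKernel_nonneg
    have h5 : B x * (Real.exp (-(2 * d)) * ∫ v in Icc (-(r * d)) (r * d), fejerKernel v) <
      c * (Real.exp (-(2 * d)) * ∫ v in Icc (-(r * d)) (r * d), fejerKernel v) := by linarith
    exact lt_of_mul_lt_mul_right h5 (by positivity)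

end Tauberian

end

section

open MeasureTheory Filter Topology Set ArithmeticFunction

lemma residueClass_one_eq_vonMangoldt (n : ℕ) :
    vonMangoldt.residueClass (1 : ZMod 1) n = Λ n := by
  simp [vonMangoldt.residueClass, indicator, eq_iff_true_of_subsingleton]

lemma sum_Icc_one_vonMangoldt (x : ℝ) : ∑ k ∈ Finset.Icc 1 ⌊x⌋₊, Λ k = Chebyshev.psi x := rfl

lemma LSeries_vonMangoldt_eq_integral {s : ℂ} (hs : 1 < s.re) :
    LSeries (fun n => (Λ n : ℂ)) s =
      s * ∫ t in Ioi (1 : ℝ), (Chebyshev.psi t : ℂ) * (t : ℂ) ^ (-(s + 1)) := by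
  rw [LSeries_eq_mul_integral_of_nonneg (fun n => Λ n) zero_le_one hs ?_ fun n => vonMangoldt_nonneg]
  · congr 1
    refine integral_congr_ae (Eventually.of_forall fun t => ?_)
    simp only [← sum_Icc_one_vonMangoldt]
    push_cast
    rfl
  · refine Asymptotics.IsBigO.of_bound (Real.log 4 + 4) (Eventually.of_forall fun n => ?_)
    have h := Chebyshev.psi_le_const_mul_self (Nat.cast_nonneg (α := ℝ) n)
    rw [← sum_Icc_one_vonMangoldt, Nat.floor_natCast] at h
    rw [Real.norm_of_nonneg (Finset.sum_nonneg fun _ _ => vonMangoldt_nonneg)]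
    simpa using h

lemma laplace_psi {s : ℂ} (hs : 0 < s.re) :
    ∫ u in Ioi (0 : ℝ), (Chebyshev.psi (Real.exp u) * Real.exp (-u) : ℝ) * Complex.exp (-s * u) =
      LSeries (fun n => (Λ n : ℂ)) (1 + s) / (1 + s) := by
  have h1 : (1 + s) ≠ 0 := fun h => by
    have := congrArg Complex.re h
    simp at this
    linarith
  rw [LSeries_vonMangoldt_eq_integral (by simpa using hs), mul_div_cancel_left₀ _ h1]
  have h2 := integral_image_eq_integral_abs_deriv_smul (s := Ioi 0) (f := Real.exp) (f' := Real.exp)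
    measurableSet_Ioi (fun x _ => (Real.hasDerivAt_exp x).hasDerivWithinAt) Real.exp_injective.injOn
    (fun t : ℝ => (Chebyshev.psi t : ℂ) * (t : ℂ) ^ (-(1 + s + 1)))
  rw [Real.image_exp_Ioi, Real.exp_zero] at h2
  rw [h2]
  refine integral_congr_ae (Eventually.of_forall fun u => ?_)
  have h3 : (Real.exp u : ℂ) ^ (-(1 + s + 1)) = Complex.exp (-(u * (1 + s + 1))) := by
    rw [Complex.cpow_def_of_ne_zero (by exact_mod_cast (Real.exp_pos u).ne'),
      ← Complex.ofReal_log (Real.exp_pos u).le, Real.log_exp]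
    ring_nf
  simp only [h3, abs_of_pos (Real.exp_pos u), Complex.real_smul]
  push_cast
  have h4 : Complex.exp u * Complex.exp (-(u * (1 + s + 1))) =
      Complex.exp (-u) * Complex.exp (-s * u) := by
    rw [← Complex.exp_add, ← Complex.exp_add]
    ring_nf
  linear_combination (-(Chebyshev.psi (Real.exp u) : ℂ)) * h4

/-- The prime number theorem, in the form `ψ(e^u) e^{-u} → 1`. -/
theorem tendsto_psi_exp :
    Tendsto (fun u => Chebyshev.psi (Real.exp u) * Real.exp (-u)) atTop (𝓝 1) := by
  have hmono := Chebyshev.psi_mono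
  have hmeas : Measurable fun u => Chebyshev.psi (Real.exp u) * Real.exp (-u) :=
    (hmono.measurable.comp Real.measurable_exp).mul (by fun_prop)
  have hneg : ∀ u ≤ 0, Chebyshev.psi (Real.exp u) * Real.exp (-u) = 0 := fun u hu => by
    rw [Chebyshev.psi_eq_zero_of_lt_two, zero_mul]
    have := Real.exp_le_one_iff.2 hu
    linarith
  refine tendsto_one_of_laplace_continuousOn (M := Real.log 4 + 4)
    (G := fun s => (vonMangoldt.LFunctionResidueClassAux (1 : ZMod 1) (1 + s) - 1) / (1 + s))
    hmeas (fun u => mul_nonneg (Chebyshev.psi_nonneg _) (Real.exp_pos _).le) ?_ hneg ?_ ?_ ?_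
  · intro u
    calc _ ≤ (Real.log 4 + 4) * Real.exp u * Real.exp (-u) :=
        mul_le_mul_of_nonneg_right (Chebyshev.psi_le_const_mul_self (Real.exp_pos _).le)
          (Real.exp_pos _).le
      _ = _ := by rw [mul_assoc, ← Real.exp_add]; simp
  · intro u s hs
    rw [mul_assoc, ← Real.exp_add, neg_add]
    exact mul_le_mul_of_nonneg_right (hmono (Real.exp_le_exp.2 (by linarith))) (Real.exp_pos _).le
  · refine ContinuousOn.div ?_ (by fun_prop) ?_
    · refine ContinuousOn.sub ?_ continuousOn_const
      exact (vonMangoldt.continuousOn_LFunctionResidueClassAux (1 : ZMod 1)).comp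
        (by fun_prop) fun s hs => by simpa using hs
    · intro s hs h
      have := congrArg Complex.re h
      simp at this hs
      linarith
  · intro s hs
    have h1 : (1 + s) ≠ 0 := fun h => by
      have := congrArg Complex.re h
      simp at this
      linarith
    have hs0 : s ≠ 0 := fun h => by simp [h] at hs
    have h2 := vonMangoldt.eqOn_LFunctionResidueClassAux (isUnit_one (M := ZMod 1))
      (show 1 + s ∈ {s : ℂ | 1 < s.re} by simpa using hs)
    simp only [residueClass_one_eq_vonMangoldt, Nat.totient_one, Nat.cast_one, inv_one,
      add_sub_cancel_left] at h2
    rw [h2]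
    have h3 := laplace_psi hs
    have hre : (-s).re < 0 := by simpa using hs
    have h4 := integral_exp_mul_complex_Ioi hre 0
    have i4 : IntegrableOn (fun u : ℝ => Complex.exp (-s * u)) (Ioi 0) :=
      integrableOn_exp_mul_complex_Ioi hre 0
    have i3 : IntegrableOn (fun u : ℝ => ((Chebyshev.psi (Real.exp u) * Real.exp (-u) : ℝ) : ℂ) *
        Complex.exp (-s * u)) (Ioi 0) := by
      refine i4.bdd_mul (c := Real.log 4 + 4)
        (Complex.measurable_ofReal.comp hmeas).aestronglyMeasurable
        (Eventually.of_forall fun u => ?_)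
      rw [Complex.norm_real, Real.norm_of_nonneg
        (mul_nonneg (Chebyshev.psi_nonneg _) (Real.exp_pos _).le)]
      calc _ ≤ (Real.log 4 + 4) * Real.exp u * Real.exp (-u) :=
          mul_le_mul_of_nonneg_right (Chebyshev.psi_le_const_mul_self (Real.exp_pos _).le)
            (Real.exp_pos _).le
        _ = _ := by rw [mul_assoc, ← Real.exp_add]; simp
    calc _ = ∫ u in Ioi (0 : ℝ), (((Chebyshev.psi (Real.exp u) * Real.exp (-u) : ℝ) : ℂ) *
          Complex.exp (-s * u) - Complex.exp (-s * u)) := by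
          rw [← integral_indicator measurableSet_Ioi]
          refine integral_congr_ae (Eventually.of_forall fun u => ?_)
          by_cases hu : 0 < u
          · simp only [mem_Ioi, hu, indicator_of_mem, Pi.one_apply]
            push_cast
            ring
          · simp only [mem_Ioi, hu, not_false_eq_true, indicator_of_notMem,
              hneg u (not_lt.1 hu)]
            simp
      _ = LSeries (fun n => (Λ n : ℂ)) (1 + s) / (1 + s) - 1 / s := by
          rw [integral_sub i3 i4, h3, h4]
          simp
      _ = _ := by
          field_simp
          ring

theorem tendsto_theta_div : Tendsto (fun x => Chebyshev.theta x / x) atTop (𝓝 1) := by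
  have h1 : Tendsto (fun x => Chebyshev.psi x / x) atTop (𝓝 1) := by
    refine (tendsto_psi_exp.comp Real.tendsto_log_atTop).congr' ?_
    filter_upwards [eventually_gt_atTop 0] with x hx
    simp only [Function.comp, Real.exp_neg, Real.exp_log hx]
    rfl
  have h2 : Tendsto (fun x : ℝ => (Chebyshev.psi x - Chebyshev.theta x) / x) atTop (𝓝 0) := by
    have h3 : Tendsto (fun x : ℝ => 2 * (Real.log x / x ^ (1 / 2 : ℝ))) atTop (𝓝 (2 * 0)) :=
      (isLittleO_log_rpow_atTop (by norm_num : (0 : ℝ) < 1 / 2)).tendsto_div_nhds_zero.const_mul 2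
    rw [mul_zero] at h3
    refine squeeze_zero_norm' ?_ h3
    filter_upwards [eventually_ge_atTop 1] with x hx
    have h4 := Chebyshev.abs_psi_sub_theta_le_sqrt_mul_log hx
    have hx0 : 0 < x := by linarith
    rw [Real.norm_eq_abs, abs_div, abs_of_pos hx0, div_le_iff₀ hx0, ← Real.sqrt_eq_rpow]
    refine h4.trans (le_of_eq ?_)
    have h5 : 0 < √x := Real.sqrt_pos.2 hx0
    field_simp
    rw [Real.sq_sqrt hx0.le]
    ring
  have h3 := h1.sub h2
  rw [sub_zero] at h3
  refine h3.congr fun x => ?_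
  ring

end

section

open Finset Nat

/-- The `2m`-smooth common multiple used to clear denominators: each prime `p ≤ 2m` occurs
with the largest exponent `e` such that `p ^ e ≤ 10m`. -/
def smoothDen (m : ℕ) : ℕ := ∏ p ∈ Icc 1 (2 * m) with p.Prime, p ^ Nat.log p (10 * m)

/-- The common factor of the coefficients of the partial fraction expansion. -/
def gainFactor (m : ℕ) : ℕ := ∏ p ∈ Ioc m (2 * m) with p.Prime, p ^ (16 * m / p - 9)

lemma smoothDen_pos (m : ℕ) : 0 < smoothDen m :=
  prod_pos fun p hp => by
    have := (mem_filter.1 hp).2.pos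
    positivity

lemma gainFactor_pos (m : ℕ) : 0 < gainFactor m :=
  prod_pos fun p hp => by
    have := (mem_filter.1 hp).2.pos
    positivity

lemma factorization_le_smoothDen {m a p : ℕ} (hp : p.Prime) (hpm : p ≤ 2 * m) (ha : a ≠ 0)
    (ham : a ≤ 10 * m) : p ^ a.factorization p ∣ smoothDen m := by
  refine Dvd.dvd.trans (pow_dvd_pow p ?_)
    (dvd_prod_of_mem _ (mem_filter.2 ⟨mem_Icc.2 ⟨hp.pos, hpm⟩, hp⟩))
  refine Nat.le_log_of_pow_le hp.one_lt ((Nat.le_of_dvd (by omega) ?_).trans ham)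
  exact Nat.ordProj_dvd a p

lemma dvd_smoothDen {m k : ℕ} (hk : k ≠ 0) (hkm : k ≤ 2 * m) : k ∣ smoothDen m := by
  rw [← Nat.factorization_prime_le_iff_dvd hk (smoothDen_pos m).ne']
  intro p hp
  by_cases hpk : p ∣ k
  · rw [← hp.pow_dvd_iff_le_factorization (smoothDen_pos m).ne']
    exact factorization_le_smoothDen hp ((Nat.le_of_dvd (by omega) hpk).trans hkm) hk (by omega)
  · simp [Nat.factorization_eq_zero_of_not_dvd hpk]

lemma lt_of_prime_dvd_div_gcd_smoothDen {m a p : ℕ} (hp : p.Prime) (ha : a ≠ 0)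
    (ham : a ≤ 10 * m) (h : p ∣ a / a.gcd (smoothDen m)) : 2 * m < p := by
  by_contra! hpm
  have h1 : p ^ a.factorization p ∣ a.gcd (smoothDen m) :=
    Nat.dvd_gcd (Nat.ordProj_dvd a p) (factorization_le_smoothDen hp hpm ha ham)
  have h2 : p ^ (a.factorization p + 1) ∣ a := by
    rw [pow_succ, ← Nat.mul_div_cancel' (Nat.gcd_dvd_left a (smoothDen m))]
    exact mul_dvd_mul (by rwa [Nat.mul_div_cancel' (Nat.gcd_dvd_left a (smoothDen m))]) h
  exact Nat.pow_succ_factorization_not_dvd ha hp h2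

/-- The prime-to-`smoothDen` part of a factorial only has prime factors exceeding `2m`. -/
lemma exists_factorial_eq_prod_gcd_mul {m n : ℕ} (hn : n ≤ 10 * m) :
    ∃ Q, n ! = (∏ a ∈ Icc 1 n, a.gcd (smoothDen m)) * Q ∧
      ∀ p, p.Prime → p ∣ Q → 2 * m < p := by
  refine ⟨∏ a ∈ Icc 1 n, a / a.gcd (smoothDen m), ?_, fun p hp h => ?_⟩
  · rw [← prod_mul_distrib, ← Finset.prod_Ico_id_eq_factorial, Finset.Ico_add_one_right_eq_Icc]
    exact prod_congr rfl fun a _ => (Nat.mul_div_cancel' (Nat.gcd_dvd_left a _)).symm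
  · obtain ⟨a, ha, hpa⟩ := (hp.prime.dvd_finsetProd_iff _).1 h
    rw [mem_Icc] at ha
    exact lt_of_prime_dvd_div_gcd_smoothDen hp (by omega) (by omega) hpa

lemma div_le_factorization_factorial {p : ℕ} (hp : p.Prime) (n : ℕ) :
    n / p ≤ (n !).factorization p := by
  rw [Nat.factorization_factorial hp (Nat.lt_succ_self (Nat.log p n)), Nat.succ_eq_add_one]
  by_cases h : p ≤ n
  · have h1 : 0 < Nat.log p n := Nat.log_pos hp.one_lt h
    have := single_le_sum (f := fun i => n / p ^ i) (s := Ico 1 (Nat.log p n + 1))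
      (fun _ _ => Nat.zero_le _) (mem_Ico.2 ⟨le_rfl, by omega⟩)
    simpa using this
  · rw [Nat.div_eq_of_lt (by omega)]
    exact Nat.zero_le _

lemma factorization_factorial_two_mul {m p : ℕ} (hm : 2 ≤ m) (hp : p.Prime) (h1 : m < p)
    (h2 : p ≤ 2 * m) : ((2 * m)!).factorization p = 1 := by
  have h3 : Nat.log p (2 * m) < 2 := by
    refine Nat.log_lt_of_lt_pow (by omega) ?_
    nlinarith
  rw [Nat.factorization_factorial hp h3]
  simp only [show Ico 1 2 = {1} from rfl, sum_singleton, pow_one]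
  exact Nat.div_eq_of_lt_le (by omega) (by omega)

lemma gainFactor_mul_factorial_dvd {m u v : ℕ} (hm : 2 ≤ m) (huv : u + v = 2 * m) :
    gainFactor m * (u ! * v !) ^ 22 ∣
      (2 * m)! ^ 14 * ((5 * u + 3 * v)! * (3 * u + 5 * v)!) := by
  have hf : ∀ a b : ℕ, (2 * m)! ^ 3 * (a ! * a !) ∣ (3 * (2 * m) + 2 * a)! := by
    intro a b
    refine dvd_trans ?_ (Nat.factorial_mul_factorial_dvd_factorial_add (3 * (2 * m)) (2 * a))
    refine mul_dvd_mul ?_ ?_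
    · have h1 := Nat.factorial_mul_factorial_dvd_factorial_add (2 * m) (2 * m)
      have h2 := Nat.factorial_mul_factorial_dvd_factorial_add (2 * m + 2 * m) (2 * m)
      rw [show 3 * (2 * m) = 2 * m + 2 * m + 2 * m by ring, pow_succ, pow_two]
      exact (mul_dvd_mul_right h1 _).trans h2
    · rw [two_mul]
      exact Nat.factorial_mul_factorial_dvd_factorial_add a a
  have hu := hf u 0
  have hv := hf v 0
  rw [show 3 * (2 * m) + 2 * u = 5 * u + 3 * v by omega] at hu
  rw [show 3 * (2 * m) + 2 * v = 3 * u + 5 * v by omega] at hv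
  obtain ⟨c, hc⟩ := huv ▸ Nat.factorial_mul_factorial_dvd_factorial_add u v
  obtain ⟨e, he⟩ := hu
  obtain ⟨f, hf⟩ := hv
  have hN : (2 * m)! ^ 14 * ((5 * u + 3 * v)! * (3 * u + 5 * v)!) =
      (u ! * v !) ^ 22 * (c ^ 20 * e * f) := by
    rw [he, hf, hc]
    ring
  set N := c ^ 20 * e * f
  rw [hN, mul_comm]
  refine mul_dvd_mul_left _ ?_
  have hne : (u ! * v !) ^ 22 * N ≠ 0 := by
    rw [← hN]
    positivity
  have hN0 : N ≠ 0 := right_ne_zero_of_mul hne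
  refine prod_dvd_of_isRelPrime ?_ ?_
  · intro p hp q hq hpq
    have hp' := (mem_filter.1 hp).2
    have hq' := (mem_filter.1 hq).2
    exact Nat.coprime_iff_isRelPrime.1 (((Nat.coprime_primes hp' hq').2 hpq).pow _ _)
  · intro p hp
    obtain ⟨hpm, hp⟩ := mem_filter.1 hp
    rw [mem_Ioc] at hpm
    rw [hp.pow_dvd_iff_le_factorization hN0]
    have h1 := factorization_factorial_two_mul hm hp hpm.1 hpm.2
    have h2 := congrArg (fun k => Nat.factorization k p) hN
    have h3 := congrArg (fun k => Nat.factorization k p) hc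
    have hc0 : c ≠ 0 := by
      rintro rfl
      rw [mul_zero] at hc
      exact (Nat.factorial_ne_zero _) hc
    have hfa := Nat.factorial_ne_zero
    simp only [Nat.factorization_mul (pow_ne_zero 14 (hfa (2 * m)))
        (mul_ne_zero (hfa (5 * u + 3 * v)) (hfa (3 * u + 5 * v))),
      Nat.factorization_mul (hfa (5 * u + 3 * v)) (hfa (3 * u + 5 * v)),
      Nat.factorization_mul (pow_ne_zero 22 (mul_ne_zero (hfa u) (hfa v))) hN0,
      Nat.factorization_mul (mul_ne_zero (hfa u) (hfa v)) hc0,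
      Nat.factorization_mul (hfa u) (hfa v), Nat.factorization_pow, Finsupp.add_apply,
      Finsupp.smul_apply, smul_eq_mul, h1] at h2 h3
    have h4 := div_le_factorization_factorial hp (5 * u + 3 * v)
    have h5 := div_le_factorization_factorial hp (3 * u + 5 * v)
    have h6 : 16 * m / p ≤ (5 * u + 3 * v) / p + (3 * u + 5 * v) / p + 1 := by
      rw [show 16 * m = (5 * u + 3 * v) + (3 * u + 5 * v) by omega,
        Nat.add_div hp.pos]
      split_ifs <;> omega
    omega

lemma gainFactor_mul_factorial_dvd_prod_gcd {m u v : ℕ} (hm : 2 ≤ m) (huv : u + v = 2 * m) :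
    gainFactor m * (u ! * v !) ^ 22 ∣
      (2 * m)! ^ 14 * ((∏ a ∈ Icc 1 (5 * u + 3 * v), a.gcd (smoothDen m)) *
        ∏ a ∈ Icc 1 (3 * u + 5 * v), a.gcd (smoothDen m)) := by
  obtain ⟨Q₁, h1, hQ₁⟩ := exists_factorial_eq_prod_gcd_mul (m := m) (n := 5 * u + 3 * v) (by omega)
  obtain ⟨Q₂, h2, hQ₂⟩ := exists_factorial_eq_prod_gcd_mul (m := m) (n := 3 * u + 5 * v) (by omega)
  have h3 := gainFactor_mul_factorial_dvd hm huv
  rw [h1, h2, mul_mul_mul_comm, ← mul_assoc] at h3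
  refine Nat.Coprime.dvd_of_dvd_mul_right ?_ h3
  refine Nat.Coprime.symm (Nat.Coprime.mul_right ?_ (Nat.Coprime.pow_right _ ?_))
  · refine Nat.coprime_of_dvd fun p hp hpQ hpg => ?_
    have h4 : 2 * m < p := by
      rcases hp.dvd_mul.1 hpQ with h | h
      exacts [hQ₁ p hp h, hQ₂ p hp h]
    obtain ⟨q, hq, hpq⟩ := (hp.prime.dvd_finsetProd_iff _).1 hpg
    obtain ⟨hqm, hq⟩ := mem_filter.1 hq
    rw [mem_Ioc] at hqm
    have := Nat.le_of_dvd hq.pos (hp.dvd_of_dvd_pow hpq)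
    omega
  · refine Nat.coprime_of_dvd fun p hp hpQ hpg => ?_
    have h4 : 2 * m < p := by
      rcases hp.dvd_mul.1 hpQ with h | h
      exacts [hQ₁ p hp h, hQ₂ p hp h]
    rcases hp.dvd_mul.1 hpg with h | h <;>
    · have := hp.dvd_factorial.1 h
      omega

end

section

open Finset Nat Polynomial

lemma prod_erase_natAbs_sub {M : Type*} [CommMonoid M] (f : ℕ → M) {a b c : ℤ} (hac : a ≤ c)
    (hcb : c ≤ b) :
    ∏ i ∈ (Icc a b).erase c, f (i - c).natAbs =
      (∏ n ∈ Icc 1 (b - c).toNat, f n) * ∏ n ∈ Icc 1 (c - a).toNat, f n := by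
  have h1 : (Icc a b).erase c = Ioc c b ∪ Ico a c := by
    ext i
    simp only [mem_erase, mem_Icc, mem_union, mem_Ioc, mem_Ico]
    omega
  have h2 : Disjoint (Ioc c b) (Ico a c) := by
    rw [Finset.disjoint_left]
    intro i
    simp only [mem_Ioc, mem_Ico]
    omega
  rw [h1, prod_union h2]
  congr 1
  · refine prod_nbij' (fun i => (i - c).natAbs) (fun n => c + n) ?_ ?_ ?_ ?_ fun _ _ => rfl <;>
    · intro i
      simp only [mem_Ioc, mem_Icc]
      omega
  · refine prod_nbij' (fun i => (i - c).natAbs) (fun n => c - n) ?_ ?_ ?_ ?_ fun _ _ => rfl <;>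
    · intro i
      simp only [mem_Ico, mem_Icc]
      omega

lemma prod_Icc_one_id (n : ℕ) : ∏ a ∈ Icc 1 n, a = n ! := by
  rw [← Finset.Ico_add_one_right_eq_Icc, Finset.prod_Ico_id_eq_factorial]

lemma exists_degree_lt_X_pow_dvd_sub {R : Type*} [CommRing R] [Nontrivial R] {W : R[X]}
    (hW : W.coeff 0 = 1) (P : R[X]) (n : ℕ) :
    ∃ β : R[X], β.degree < n ∧ X ^ n ∣ P - W * β := by
  have h1 : IsCoprime W (X ^ n) := by
    refine IsCoprime.pow_right ?_
    obtain ⟨q, hq⟩ : X ∣ W - 1 := by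
      rw [X_dvd_iff]
      simp [hW]
    exact ⟨1, -q, by linear_combination hq⟩
  obtain ⟨a, b, hab⟩ := h1
  have hmonic : (X ^ n : R[X]).Monic := monic_X_pow n
  refine ⟨(P * a) %ₘ X ^ n, ?_, ?_⟩
  · have := degree_modByMonic_lt (P * a) hmonic
    rwa [degree_X_pow] at this
  · have h2 := modByMonic_add_div (P * a) (X ^ n)
    refine ⟨P * b + W * ((P * a) /ₘ X ^ n), ?_⟩
    linear_combination (-P) * hab - W * h2

/-- Laurent expansion at a pole, with integral coefficients after removing the common factor. -/
lemma exists_local_expansion {m : ℕ} (hm : 2 ≤ m) {j : ℤ} (hj : j ∈ Icc (-m : ℤ) m) :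
    ∃ β : ℤ[X], β.degree < (21 : ℕ) ∧
      X ^ 21 ∣ C (((2 * m)! : ℤ) ^ 14) * (∏ i ∈ (Icc (-(8 * m) : ℤ) (8 * m)).erase (2 * j),
          (C (i - 2 * j) + C (2 * smoothDen m : ℤ) * X)) -
        C (gainFactor m : ℤ) * (∏ k ∈ (Icc (-m : ℤ) m).erase j,
          (C (k - j) + C (smoothDen m : ℤ) * X)) ^ 22 * β := by
  rw [mem_Icc] at hj
  set D : ℤ := (smoothDen m : ℤ) with hD
  obtain ⟨u, hu⟩ : ∃ u : ℕ, (u : ℤ) = m - j := ⟨(m - j).toNat, by omega⟩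
  obtain ⟨v, hv⟩ : ∃ v : ℕ, (v : ℤ) = m + j := ⟨(m + j).toNat, by omega⟩
  have huv : u + v = 2 * m := by omega
  obtain ⟨E, hE⟩ := gainFactor_mul_factorial_dvd_prod_gcd hm huv
  -- the numerator
  set g : ℤ → ℤ := fun x => (x.natAbs.gcd (smoothDen m) : ℕ) with hg
  have hgx : ∀ x, g x ∣ x := fun x => Int.natCast_dvd.2 (Nat.gcd_dvd_left _ _)
  have hgD : ∀ x, g x ∣ 2 * D := fun x => 
    Dvd.dvd.mul_left (Int.natCast_dvd_natCast.2 (Nat.gcd_dvd_right _ _)) _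
  have hnum : ∏ i ∈ (Icc (-(8 * m) : ℤ) (8 * m)).erase (2 * j), (C (i - 2 * j) + C (2 * D) * X) =
      C (((∏ a ∈ Icc 1 (3 * v + 5 * u), a.gcd (smoothDen m)) *
        ∏ a ∈ Icc 1 (5 * v + 3 * u), a.gcd (smoothDen m) : ℕ) : ℤ) *
      ∏ i ∈ (Icc (-(8 * m) : ℤ) (8 * m)).erase (2 * j),
        (C ((i - 2 * j) / g (i - 2 * j)) + C (2 * D / g (i - 2 * j)) * X) := by
    have h1 := prod_erase_natAbs_sub (fun n => n.gcd (smoothDen m)) (a := -(8 * m)) (b := 8 * m)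
      (c := 2 * j) (by omega) (by omega)
    rw [show (8 * m - 2 * j : ℤ).toNat = 3 * v + 5 * u by omega,
      show (2 * j - -(8 * m) : ℤ).toNat = 5 * v + 3 * u by omega] at h1
    rw [← h1, Nat.cast_prod, map_prod, ← prod_mul_distrib]
    refine prod_congr rfl fun i _ => ?_
    rw [mul_add, ← mul_assoc, ← C_mul, ← C_mul]
    change _ = C (g (i - 2 * j) * ((i - 2 * j) / g (i - 2 * j))) + 
      C (g (i - 2 * j) * (2 * D / g (i - 2 * j))) * X
    rw [Int.mul_ediv_cancel' (hgx _), Int.mul_ediv_cancel' (hgD _)]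
  -- the denominator
  set V : ℤ[X] := ∏ k ∈ (Icc (-m : ℤ) m).erase j, (1 + C (D / (k - j)) * X) with hV
  have hden : ∏ k ∈ (Icc (-m : ℤ) m).erase j, (C (k - j) + C D * X) =
      C (∏ k ∈ (Icc (-m : ℤ) m).erase j, (k - j)) * V := by
    rw [map_prod, hV, ← prod_mul_distrib]
    refine prod_congr rfl fun k hk => ?_
    simp only [mem_erase, mem_Icc] at hk
    have h1 : k - j ∣ D := by
      rw [hD, Int.dvd_natCast]
      exact dvd_smoothDen (by omega) (by omega)
    rw [mul_add, mul_one, ← mul_assoc, ← C_mul, Int.mul_ediv_cancel' h1]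
  have hfac : (∏ k ∈ (Icc (-m : ℤ) m).erase j, (k - j)) ^ 22 = ((u ! * v ! : ℕ) : ℤ) ^ 22 := by
    have h1 := prod_erase_natAbs_sub (fun n => n) (a := -m) (b := m)
      (c := j) (by omega) (by omega)
    rw [show (m - j : ℤ).toNat = u by omega, show (j - -m : ℤ).toNat = v by omega,
      prod_Icc_one_id, prod_Icc_one_id] at h1
    have h2 : Even 22 := by decide
    rw [← h1, ← h2.pow_abs, Finset.abs_prod, Nat.cast_prod]
    simp only [Int.natCast_natAbs]
  have hV0 : (V ^ 22).coeff 0 = 1 := by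
    rw [coeff_zero_eq_eval_zero, hV, eval_pow, eval_prod]
    simp
  obtain ⟨β, hβ, hdvd⟩ := exists_degree_lt_X_pow_dvd_sub hV0
    (C (E : ℤ) * ∏ i ∈ (Icc (-(8 * m) : ℤ) (8 * m)).erase (2 * j),
        (C ((i - 2 * j) / g (i - 2 * j)) + C (2 * D / g (i - 2 * j)) * X)) 21
  refine ⟨β, hβ, ?_⟩
  rw [hnum, hden, mul_pow, ← C_pow, hfac]
  refine (hdvd.mul_left (C ((gainFactor m * (u ! * v !) ^ 22 : ℕ) : ℤ))).trans (dvd_of_eq ?_)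
  have hE' := congrArg (fun n : ℕ => C (n : ℤ)) hE
  simp only [add_comm (5 * u), add_comm (3 * u)] at hE'
  push_cast [C_mul] at hE' ⊢
  linear_combination (-∏ i ∈ (Icc (-(8 * m) : ℤ) (8 * m)).erase (2 * j),
        (C ((i - 2 * j) / g (i - 2 * j)) + C (2 * D / g (i - 2 * j)) * X)) * hE'

lemma eq_sum_of_local_expansions {ι K : Type*} [DecidableEq ι] [Field K] {s : Finset ι} {a : ι → K}
    (ha : Set.InjOn a s) {e : ℕ} {N : K[X]} {q : ι → K[X]}
    (hq : ∀ j ∈ s, (q j).natDegree < e) (hN : N.natDegree < e * #s)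
    (h : ∀ j ∈ s, (X - C (a j)) ^ e ∣ N - (∏ k ∈ s.erase j, (X - C (a k))) ^ e * q j) :
    N = ∑ j ∈ s, (∏ k ∈ s.erase j, (X - C (a k))) ^ e * q j := by
  set S := ∑ j ∈ s, (∏ k ∈ s.erase j, (X - C (a k))) ^ e * q j with hS
  rw [← sub_eq_zero]
  have hdvd : (∏ j ∈ s, (X - C (a j)) ^ e) ∣ N - S := by
    refine Finset.prod_dvd_of_coprime ?_ fun j hj => ?_
    · intro i hi j hj hij
      have h1 : a i - a j ≠ 0 := sub_ne_zero.2 fun h => hij (ha hi hj h)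
      exact IsCoprime.pow (isCoprime_X_sub_C_of_isUnit_sub h1.isUnit)
    · rw [hS, ← add_sum_erase s _ hj, ← sub_sub]
      refine dvd_sub (h j hj) (dvd_sum fun k hk => ?_)
      refine Dvd.dvd.mul_right (pow_dvd_pow_of_dvd
        (dvd_prod_of_mem (fun i => X - C (a i)) ?_) e) _
      simp only [mem_erase] at hk ⊢
      exact ⟨hk.1.symm, hj⟩
  have hdeg : (∏ j ∈ s, (X - C (a j)) ^ e).natDegree = e * #s := by
    rw [natDegree_prod_of_monic _ _ fun j _ => (monic_X_sub_C _).pow _]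
    simp [mul_comm]
  refine eq_zero_of_dvd_of_natDegree_lt hdvd ?_
  rw [hdeg]
  have hpos : 0 < e * #s := by omega
  have hSdeg : S.natDegree ≤ e * #s - 1 := by
    refine natDegree_sum_le_of_forall_le _ _ fun j hj => ?_
    refine natDegree_mul_le.trans ?_
    rw [natDegree_pow, natDegree_prod_of_monic _ _ fun j _ => (monic_X_sub_C _)]
    simp only [natDegree_X_sub_C, sum_const, smul_eq_mul, mul_one, card_erase_of_mem hj]
    have h1 := hq j hj
    have h2 : 0 < #s := card_pos.2 ⟨j, hj⟩
    obtain ⟨t, ht⟩ : ∃ t, #s = t + 1 := ⟨#s - 1, by omega⟩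
    rw [ht, Nat.add_sub_cancel, mul_add, mul_one]
    omega
  refine (natDegree_sub_le _ _).trans_lt ?_
  rw [max_lt_iff]
  omega

end

section

open Finset Nat Polynomial

/-- The odd rational function whose values are summed. -/
noncomputable def ratFun (m : ℕ) (T : ℝ) : ℝ :=
  ((2 * m)! : ℝ) ^ 14 * (∏ i ∈ Icc (-(8 * m) : ℤ) (8 * m), (2 * T + i)) /
    (∏ j ∈ Icc (-m : ℤ) m, (T + j)) ^ 22

lemma natDegree_lt_of_degree_lt {R : Type*} [Semiring R] {p : R[X]} {n : ℕ} (hn : 0 < n)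
    (h : p.degree < n) : p.natDegree < n := by
  by_cases h0 : p = 0
  · simpa [h0] using hn
  · exact (natDegree_lt_iff_degree_lt h0).2 h

lemma sum_coeff_mul_pow_div {β : ℤ[X]} {n : ℕ} (hβ : β.degree < n) {y : ℝ} (hy : y ≠ 0) :
    (β.map (Int.castRingHom ℝ)).eval y / y ^ n =
      ∑ l ∈ Icc 1 n, (β.coeff (n - l) : ℝ) * (1 / y) ^ l := by
  have h1 : (β.map (Int.castRingHom ℝ)).degree < n := (degree_map_le).trans_lt hβ
  rcases Nat.eq_zero_or_pos n with rfl | hn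
  · have : β = 0 := by
      rw [← degree_eq_bot]
      exact Nat.WithBot.lt_zero_iff.1 (by exact_mod_cast hβ)
    simp [this]
  rw [eval_eq_sum_range' (natDegree_lt_of_degree_lt hn h1), sum_div]
  refine sum_nbij' (fun i => n - i) (fun l => n - l) ?_ ?_ ?_ ?_ fun i hi => ?_
  · intro i; simp only [mem_range, mem_Icc]; omega
  · intro i; simp only [mem_range, mem_Icc]; omega
  · intro i; simp only [mem_range]; omega
  · intro i; simp only [mem_Icc]; omega
  · rw [mem_range] at hi
    rw [Nat.sub_sub_self hi.le, coeff_map, one_div, inv_pow, eq_intCast, mul_div_assoc]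
    congr 1
    rw [div_eq_iff (by positivity), ← div_eq_inv_mul, eq_div_iff (by positivity), ← pow_add]
    congr 1
    omega

lemma partial_fraction_dvd {m : ℕ} {j : ℤ} (hj : j ∈ Icc (-m : ℤ) m) {β : ℤ[X]}
    (hdvd : X ^ 21 ∣ C (((2 * m)! : ℤ) ^ 14) * (∏ i ∈ (Icc (-(8 * m) : ℤ) (8 * m)).erase (2 * j),
          (C (i - 2 * j) + C (2 * smoothDen m : ℤ) * X)) -
        C (gainFactor m : ℤ) * (∏ k ∈ (Icc (-m : ℤ) m).erase j,
          (C (k - j) + C (smoothDen m : ℤ) * X)) ^ 22 * β) :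
    (X - C (-j : ℝ)) ^ 22 ∣
      C ((smoothDen m : ℝ) ^ 21 * ((2 * m)! : ℝ) ^ 14) *
          (∏ i ∈ Icc (-(8 * m) : ℤ) (8 * m), (2 * X + C (i : ℝ))) -
        (∏ k ∈ (Icc (-m : ℤ) m).erase j, (X - C (-k : ℝ))) ^ 22 *
          (C (2 * gainFactor m * (smoothDen m : ℝ) ^ 21) * (X - C (-j : ℝ)) *
            (β.map (Int.castRingHom ℝ)).comp (C ((smoothDen m : ℝ)⁻¹) * (X - C (-j : ℝ)))) := by
  obtain ⟨H, hH⟩ := hdvd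
  have hD : (smoothDen m : ℝ) ≠ 0 := by exact_mod_cast (smoothDen_pos m).ne'
  obtain ⟨D, hDdef⟩ : ∃ D : ℝ, D = smoothDen m := ⟨_, rfl⟩
  rw [← hDdef] at hD ⊢
  set Y : ℝ[X] := C D⁻¹ * (X - C (-j : ℝ)) with hY
  have hDY : C D * Y = X - C (-j : ℝ) := by
    rw [hY, ← mul_assoc, ← C_mul, mul_inv_cancel₀ hD, C_1, one_mul]
  have h1 := congrArg (fun p : ℤ[X] => (p.map (Int.castRingHom ℝ)).comp Y) hH
  simp only [Polynomial.map_sub, Polynomial.map_mul, Polynomial.map_pow, Polynomial.map_prod,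
    Polynomial.map_add, map_C, map_X, sub_comp, mul_comp, pow_comp, Polynomial.prod_comp, add_comp, C_comp,
    X_comp, Int.coe_castRingHom, Int.cast_sub, Int.cast_mul, Int.cast_pow, Int.cast_natCast,
    Int.cast_ofNat] at h1
  simp only [← hDdef] at h1
  have e1 : ∀ i : ℤ, C ((i : ℝ) - 2 * j) + C (2 * D) * Y = 2 * X + C (i : ℝ) := fun i => by
    rw [C_mul, mul_assoc, hDY]
    simp only [C_sub, C_mul, C_neg, C_ofNat]
    ring
  have e2 : ∀ k : ℤ, C ((k : ℝ) - j) + C D * Y = X - C (-k : ℝ) := fun k => by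
    rw [hDY]
    simp only [C_sub, C_neg]
    ring
  simp only [e1, e2] at h1
  rw [mem_Icc] at hj
  rw [← mul_prod_erase _ _ (show 2 * j ∈ Icc (-(8 * m) : ℤ) (8 * m) by rw [mem_Icc]; omega)]
  have e3 : (2 * X + C (((2 * j : ℤ) : ℝ)) : ℝ[X]) = 2 * (X - C (-j : ℝ)) := by
    push_cast
    simp only [C_mul, C_neg, C_ofNat]
    ring
  have hDY2 : C D ^ 21 * Y ^ 21 = (X - C (-j : ℝ)) ^ 21 := by rw [← mul_pow, hDY]
  refine ⟨2 * (H.map (Int.castRingHom ℝ)).comp Y, ?_⟩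
  rw [e3]
  simp only [C_mul, C_pow, C_ofNat] at h1 ⊢
  linear_combination (2 * (X - C (-j : ℝ)) * C D ^ 21) * h1 +
    2 * (X - C (-j : ℝ)) * (H.map (Int.castRingHom ℝ)).comp Y * hDY2

/-- Partial fraction expansion of `ratFun` with coefficients that are integral after
multiplication by a power of `smoothDen` and division by `gainFactor`. -/
theorem exists_partial_fractions {m : ℕ} (hm : 2 ≤ m) : ∃ b : ℤ → ℕ → ℤ, ∀ T : ℝ,
    (∀ j ∈ Icc (-m : ℤ) m, T + j ≠ 0) →
      (smoothDen m : ℝ) ^ 21 * ratFun m T = 2 * gainFactor m *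
        ∑ j ∈ Icc (-m : ℤ) m, ∑ l ∈ Icc 1 21, (b j l : ℝ) * (smoothDen m / (T + j)) ^ l := by
  have hloc : ∀ j : ℤ, ∃ β : ℤ[X], j ∈ Icc (-m : ℤ) m → β.degree < (21 : ℕ) ∧ 
      (X - C (-j : ℝ)) ^ 22 ∣
      C ((smoothDen m : ℝ) ^ 21 * ((2 * m)! : ℝ) ^ 14) *
          (∏ i ∈ Icc (-(8 * m) : ℤ) (8 * m), (2 * X + C (i : ℝ))) -
        (∏ k ∈ (Icc (-m : ℤ) m).erase j, (X - C (-k : ℝ))) ^ 22 *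
          (C (2 * gainFactor m * (smoothDen m : ℝ) ^ 21) * (X - C (-j : ℝ)) *
            (β.map (Int.castRingHom ℝ)).comp
              (C ((smoothDen m : ℝ)⁻¹) * (X - C (-j : ℝ)))) := by
    intro j
    by_cases hj : j ∈ Icc (-m : ℤ) m
    · obtain ⟨β, h1, h2⟩ := exists_local_expansion hm hj
      exact ⟨β, fun _ => ⟨h1, partial_fraction_dvd hj h2⟩⟩
    · exact ⟨0, fun h => absurd h hj⟩
  choose β hβ using hloc
  refine ⟨fun j l => (β j).coeff (21 - l), fun T hT => ?_⟩
  have hD : (smoothDen m : ℝ) ≠ 0 := by exact_mod_cast (smoothDen_pos m).ne'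
  have hcard : #(Icc (-m : ℤ) m) = 2 * m + 1 := by
    rw [Int.card_Icc]
    omega
  have hdeg1 : ∀ x : ℝ, (X - C x).natDegree ≤ 1 := fun x => (natDegree_X_sub_C x).le
  have key := eq_sum_of_local_expansions (s := Icc (-m : ℤ) m) (a := fun j : ℤ => (-j : ℝ))
    (fun i _ j _ h => by simpa using h) (e := 22)
    (N := C ((smoothDen m : ℝ) ^ 21 * ((2 * m)! : ℝ) ^ 14) *
          (∏ i ∈ Icc (-(8 * m) : ℤ) (8 * m), (2 * X + C (i : ℝ))))
    (q := fun j => C (2 * gainFactor m * (smoothDen m : ℝ) ^ 21) * (X - C (-j : ℝ)) *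
            ((β j).map (Int.castRingHom ℝ)).comp
              (C ((smoothDen m : ℝ)⁻¹) * (X - C (-j : ℝ)))) ?_ ?_ (fun j hj => (hβ j hj).2)
  · have h1 := congrArg (eval T) key
    simp only [eval_mul, eval_C, eval_prod, eval_add, eval_X, eval_ofNat, eval_finsetSum,
      eval_pow, eval_sub, eval_comp, sub_neg_eq_add] at h1
    rw [ratFun, ← mul_div_assoc, ← mul_assoc, h1, sum_div, mul_sum]
    refine sum_congr rfl fun j hj => ?_
    have hTj := hT j hj
    have h2 := sum_coeff_mul_pow_div (hβ j hj).1 (y := (smoothDen m : ℝ)⁻¹ * (T + j))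
      (mul_ne_zero (inv_ne_zero hD) hTj)
    have h3 : 1 / ((smoothDen m : ℝ)⁻¹ * (T + j)) = smoothDen m / (T + j) := by
      field_simp
    rw [h3] at h2
    rw [← h2, ← mul_prod_erase _ _ hj]
    have h4 : ∏ k ∈ (Icc (-m : ℤ) m).erase j, (T + k) ≠ 0 :=
      prod_ne_zero_iff.2 fun k hk => hT k (mem_of_mem_erase hk)
    rw [mul_pow, mul_pow, inv_pow]
    field_simp
  · intro j hj
    have h1 : (C ((smoothDen m : ℝ)⁻¹) * (X - C (-j : ℝ))).natDegree ≤ 1 :=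
      (natDegree_C_mul_le _ _).trans (hdeg1 _)
    have h2 : ((β j).map (Int.castRingHom ℝ)).natDegree ≤ 20 :=
      natDegree_map_le.trans (Nat.lt_succ_iff.1 (natDegree_lt_of_degree_lt
        (by norm_num) (hβ j hj).1))
    have h3 := natDegree_comp_le (p := (β j).map (Int.castRingHom ℝ))
      (q := C ((smoothDen m : ℝ)⁻¹) * (X - C (-j : ℝ)))
    have h4 := Nat.mul_le_mul h2 h1
    refine (natDegree_mul_le.trans (Nat.add_le_add ((natDegree_C_mul_le _ _).trans (hdeg1 _))
      (h3.trans h4))).trans_lt (by norm_num)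
  · rw [hcard]
    refine (natDegree_C_mul_le _ _).trans_lt ((natDegree_prod_le _ _).trans_lt ?_)
    refine (sum_le_card_nsmul _ _ 1 fun i _ => ?_).trans_lt ?_
    · compute_degree
    · rw [Int.card_Icc, smul_eq_mul]
      omega

end

section

open Finset Filter Topology

lemma hasSum_zetaR {l : ℕ} (hl : 2 ≤ l) : HasSum (fun n : ℕ => 1 / (n + 1 : ℝ) ^ l) (zetaR l) := by
  have h := (summable_nat_add_iff 1).2 (Real.summable_one_div_nat_pow.2 (show 1 < l by omega))
  push_cast at h
  exact h.hasSum

lemma hasSum_half_zetaR {l : ℕ} (hl : 2 ≤ l) :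
    HasSum (fun n : ℕ => 1 / (n + 1 / 2 : ℝ) ^ l) ((2 ^ l - 1) * zetaR l) := by
  set f : ℕ → ℝ := fun n => 1 / (n + 1 : ℝ) ^ l with hf
  have h : HasSum f (zetaR l) := hasSum_zetaR hl
  have hodd : HasSum (fun k : ℕ => f (2 * k + 1)) ((1 / 2 ^ l) * zetaR l) := by
    have h1 : (fun k : ℕ => f (2 * k + 1)) = fun k => 1 / 2 ^ l * f k := by
      funext k
      simp only [hf]
      rw [one_div_mul_one_div, ← mul_pow]
      push_cast
      ring_nf
    rw [h1]
    exact h.mul_left (1 / 2 ^ l)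
  have heven : Summable fun k : ℕ => f (2 * k) :=
    h.summable.comp_injective (i := fun k : ℕ => 2 * k) fun a b hab => by simpa using hab
  have h1 := (heven.hasSum.even_add_odd (f := f) hodd).unique h
  have h2 := heven.hasSum.mul_left (2 ^ l)
  have h3 : (fun k : ℕ => 2 ^ l * f (2 * k)) = fun n : ℕ => 1 / (n + 1 / 2 : ℝ) ^ l := by
    funext k
    simp only [hf]
    rw [Nat.cast_mul, Nat.cast_two, show (2 * (k : ℝ) + 1) = 2 * (k + 1 / 2) by ring, mul_pow,
      ← one_div_mul_one_div, ← mul_assoc, mul_one_div_cancel (by positivity), one_mul]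
  have h4 : (2 : ℝ) ^ l * ∑' k, f (2 * k) = (2 ^ l - 1) * zetaR l := by
    rw [eq_sub_of_add_eq h1]
    field_simp
  rwa [h3, h4] at h2

lemma tendsto_sum_shift {φ : ℤ → ℝ} {a b i j : ℤ}
    (h0 : ∀ j : ℤ, Tendsto (fun N : ℕ => φ (N + j)) atTop (𝓝 0))
    (hInt : ∀ z, a ≤ z → z < b → ∃ n : ℤ, φ z = n) (hi : i ∈ Icc a b) (hj : j ∈ Icc a b) :
    ∃ e : ℤ, Tendsto (fun N : ℕ => ∑ t ∈ range N, (φ (t + j) - φ (t + i))) atTop (𝓝 (e : ℝ)) := by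
  have key : ∀ k : ℤ, a ≤ k → k ≤ b → ∃ e : ℤ,
      Tendsto (fun N : ℕ => ∑ t ∈ range N, (φ (t + k) - φ (t + a))) atTop (𝓝 (e : ℝ)) := by
    intro k hk
    induction k, hk using Int.leInduction with
    | base => exact fun _ => ⟨0, by simp⟩
    | succ k hk ih =>
      intro hkb
      obtain ⟨e, he⟩ := ih (by omega)
      obtain ⟨n, hn⟩ := hInt k hk (by omega)
      refine ⟨e + (0 - n), ?_⟩
      push_cast
      refine (he.add ((h0 k).sub_const (n : ℝ))).congr fun N => ?_
      have h1 := sum_range_sub (fun t : ℕ => φ (t + k)) N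
      rw [Nat.cast_zero, zero_add, hn] at h1
      rw [← h1, ← sum_add_distrib]
      refine sum_congr rfl fun t _ => ?_
      push_cast
      rw [add_right_comm, add_assoc (t : ℤ) k 1]
      ring
  rw [mem_Icc] at hi hj
  obtain ⟨e, he⟩ := key i hi.1 hi.2
  obtain ⟨f, hf⟩ := key j hj.1 hj.2
  refine ⟨f - e, ?_⟩
  push_cast
  refine (hf.sub he).congr fun N => ?_
  rw [← sum_sub_distrib]
  exact sum_congr rfl fun t _ => by ring

lemma tendsto_sum_partial_fractions {c : ℤ → ℕ → ℤ} {φ : ℕ → ℤ → ℝ} {Z : ℕ → ℝ} {a b i : ℤ} {n : ℕ}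
    (h0 : ∀ l ∈ Icc 1 n, ∀ j : ℤ, Tendsto (fun N : ℕ => φ l (N + j)) atTop (𝓝 0))
    (hInt : ∀ l ∈ Icc 1 n, ∀ z, a ≤ z → z < b → ∃ n : ℤ, φ l z = n) (hi : i ∈ Icc a b)
    (hc : ∑ j ∈ Icc a b, c j 1 = 0)
    (hZ : ∀ l ∈ Icc 2 n, Tendsto (fun N : ℕ => ∑ t ∈ range N, φ l (t + i)) atTop (𝓝 (Z l))) :
    ∃ e : ℤ, Tendsto (fun N : ℕ => ∑ t ∈ range N, ∑ j ∈ Icc a b, ∑ l ∈ Icc 1 n,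
      (c j l : ℝ) * φ l (t + j)) atTop
      (𝓝 (e + ∑ l ∈ Icc 2 n, ((∑ j ∈ Icc a b, c j l : ℤ) : ℝ) * Z l)) := by
  have h1 : ∀ l j, ∃ e : ℤ, l ∈ Icc 1 n → j ∈ Icc a b →
      Tendsto (fun N : ℕ => ∑ t ∈ range N, (φ l (t + j) - φ l (t + i))) atTop (𝓝 (e : ℝ)) := by
    intro l j
    by_cases h : l ∈ Icc 1 n ∧ j ∈ Icc a b
    · obtain ⟨e, he⟩ := tendsto_sum_shift (h0 l h.1) (hInt l h.1) hi h.2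
      exact ⟨e, fun _ _ => he⟩
    · exact ⟨0, fun h1 h2 => absurd ⟨h1, h2⟩ h⟩
  choose e he using h1
  refine ⟨∑ j ∈ Icc a b, ∑ l ∈ Icc 1 n, c j l * e l j, ?_⟩
  push_cast
  have h2 : Tendsto (fun N : ℕ => ∑ j ∈ Icc a b, ∑ l ∈ Icc 1 n,
      (c j l : ℝ) * ∑ t ∈ range N, (φ l (t + j) - φ l (t + i))) atTop
      (𝓝 (∑ j ∈ Icc a b, ∑ l ∈ Icc 1 n, (c j l : ℝ) * e l j)) :=
    tendsto_finsetSum _ fun j hj => tendsto_finsetSum _ fun l hl => (he l j hl hj).const_mul _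
  have h3 : Tendsto (fun N : ℕ => ∑ l ∈ Icc 2 n, (∑ j ∈ Icc a b, (c j l : ℝ)) *
      ∑ t ∈ range N, φ l (t + i)) atTop
      (𝓝 (∑ l ∈ Icc 2 n, (∑ j ∈ Icc a b, (c j l : ℝ)) * Z l)) :=
    tendsto_finsetSum _ fun l hl => (hZ l hl).const_mul _
  refine (h2.add h3).congr fun N => ?_
  have h4 : ∑ l ∈ Icc 2 n, (∑ j ∈ Icc a b, (c j l : ℝ)) * ∑ t ∈ range N, φ l (t + i) =
      ∑ l ∈ Icc 1 n, (∑ j ∈ Icc a b, (c j l : ℝ)) * ∑ t ∈ range N, φ l (t + i) := by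
    refine sum_subset (Icc_subset_Icc_left (by norm_num)) fun l hl hl' => ?_
    have : l = 1 := by
      simp only [mem_Icc] at hl hl'
      omega
    have h5 : ∑ j ∈ Icc a b, (c j 1 : ℝ) = 0 := by exact_mod_cast hc
    rw [this, h5, zero_mul]
  rw [h4]
  simp only [sum_mul]
  rw [sum_comm (s := Icc 1 n), ← sum_add_distrib, sum_comm (s := range N)]
  refine sum_congr rfl fun j _ => ?_
  rw [← sum_add_distrib, sum_comm (s := range N)]
  refine sum_congr rfl fun l _ => ?_
  rw [← mul_add, ← sum_add_distrib, mul_sum]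
  exact sum_congr rfl fun t _ => by ring

end

section

open Finset Filter Topology

lemma prod_Icc_neg_add_neg (n : ℕ) (x : ℝ) :
    ∏ i ∈ Icc (-n : ℤ) n, (-x + i) = -∏ i ∈ Icc (-n : ℤ) n, (x + i) := by
  have h1 : ∏ i ∈ Icc (-n : ℤ) n, (-x + i) = ∏ i ∈ Icc (-n : ℤ) n, (-1 * (x + i)) := by
    refine prod_nbij' (fun i => -i) (fun i => -i) ?_ ?_ ?_ ?_ ?_
    · intro i hi
      simp only [mem_Icc] at *
      omega
    · intro i hi
      simp only [mem_Icc] at *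
      omega
    · simp
    · simp
    · intro i _
      push_cast
      ring
  rw [h1, prod_mul_distrib, prod_const, Int.card_Icc,
    show ((n : ℤ) + 1 - -n).toNat = 2 * n + 1 by omega, pow_succ, pow_mul]
  norm_num

lemma ratFun_neg (m : ℕ) (T : ℝ) : ratFun m (-T) = -ratFun m T := by
  have h1 := prod_Icc_neg_add_neg (8 * m) (2 * T)
  have h2 := prod_Icc_neg_add_neg m T
  push_cast at h1
  unfold ratFun
  rw [mul_neg, h1, h2, Even.neg_pow (by decide)]
  ring

lemma tendsto_mul_ratFun (m : ℕ) : Tendsto (fun T => T * ratFun m T) atTop (𝓝 0) := by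
  set P : Polynomial ℝ := Polynomial.X * ∏ i ∈ Icc (-(8 * m) : ℤ) (8 * m),
    (2 * Polynomial.X + Polynomial.C (i : ℝ)) with hP
  set Q : Polynomial ℝ := (∏ j ∈ Icc (-m : ℤ) m, (Polynomial.X + Polynomial.C (j : ℝ))) ^ 22 with hQ
  have hQm : (∏ j ∈ Icc (-m : ℤ) m, (Polynomial.X + Polynomial.C (j : ℝ))).Monic :=
    Polynomial.monic_prod_of_monic _ _ fun j _ => Polynomial.monic_X_add_C _
  have hQd : Q.natDegree = 22 * (2 * m + 1) := by
    rw [hQ, hQm.natDegree_pow, Polynomial.natDegree_prod_of_monic _ _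
      fun j _ => Polynomial.monic_X_add_C _]
    simp only [Polynomial.natDegree_X_add_C, sum_const, Int.card_Icc]
    rw [show ((m : ℤ) + 1 - -m).toNat = 2 * m + 1 by omega]
    simp
  have hPd : P.natDegree ≤ 1 + (16 * m + 1) := by
    refine Polynomial.natDegree_mul_le.trans (add_le_add Polynomial.natDegree_X_le ?_)
    refine (Polynomial.natDegree_prod_le _ _).trans ?_
    refine (sum_le_card_nsmul _ _ 1 fun i _ => ?_).trans ?_
    · compute_degree
    · rw [Int.card_Icc]
      simp only [smul_eq_mul]
      omega
  have hdeg : P.degree < Q.degree := Polynomial.degree_lt_degree (by omega)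
  have h := (Polynomial.div_tendsto_atTop_zero_of_degree_lt P Q hdeg).const_mul (((2 * m).factorial : ℝ) ^ 14)
  rw [mul_zero] at h
  refine h.congr fun T => ?_
  simp only [hP, hQ, ratFun, Polynomial.eval_mul, Polynomial.eval_X, Polynomial.eval_prod,
    Polynomial.eval_pow, Polynomial.eval_add, Polynomial.eval_C, Polynomial.eval_ofNat]
  ring

lemma sum_residues_eq_zero {m n : ℕ} {b : ℤ → ℕ → ℤ} {D : ℝ} (hD : D ≠ 0) (hn : 1 ≤ n)
    (h : Tendsto (fun T : ℝ => T * ∑ j ∈ Icc (-m : ℤ) m, ∑ l ∈ Icc 1 n, (b j l : ℝ) *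
      (D / (T + j)) ^ l) atTop (𝓝 0)) : ∑ j ∈ Icc (-m : ℤ) m, b j 1 = 0 := by
  have h0 : ∀ j : ℤ, Tendsto (fun T : ℝ => D / (T + j)) atTop (𝓝 0) := fun j =>
    (tendsto_atTop_add_const_right _ _ tendsto_id).const_div_atTop D
  have h1 : ∀ j : ℤ, Tendsto (fun T : ℝ => T * (D / (T + j))) atTop (𝓝 D) := by
    intro j
    have := ((h0 j).mul_const (j : ℝ)).const_sub D
    rw [zero_mul, sub_zero] at this
    refine this.congr' ?_
    filter_upwards [eventually_gt_atTop (-(j : ℝ))] with T hT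
    have : T + j ≠ 0 := by linarith
    field_simp
    ring
  have h2 : ∀ j : ℤ, ∀ l ∈ Icc 1 n, Tendsto (fun T : ℝ => T * ((b j l : ℝ) * (D / (T + j)) ^ l)) atTop
      (𝓝 (if l = 1 then (b j 1 : ℝ) * D else 0)) := by
    intro j l hl
    rw [mem_Icc] at hl
    have := ((h1 j).mul ((h0 j).pow (l - 1))).const_mul (b j l : ℝ)
    have e : (b j l : ℝ) * (D * 0 ^ (l - 1)) = if l = 1 then (b j 1 : ℝ) * D else 0 := by
      split_ifs with h
      · simp [h]
      · rw [zero_pow (by omega)]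
        simp
    rw [e] at this
    refine this.congr fun T => ?_
    obtain ⟨k, rfl⟩ : ∃ k, l = k + 1 := ⟨l - 1, by omega⟩
    rw [Nat.add_sub_cancel, pow_succ]
    ring
  have h3 : Tendsto (fun T : ℝ => T * ∑ j ∈ Icc (-m : ℤ) m, ∑ l ∈ Icc 1 n, (b j l : ℝ) *
      (D / (T + j)) ^ l) atTop
      (𝓝 (∑ j ∈ Icc (-m : ℤ) m, ∑ l ∈ Icc 1 n, if l = 1 then (b j 1 : ℝ) * D else 0)) := by
    simp only [mul_sum]
    exact tendsto_finsetSum _ fun j _ => tendsto_finsetSum _ fun l hl => h2 j l hl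
  have h4 := tendsto_nhds_unique h3 h
  simp only [sum_ite_eq', mem_Icc, le_refl, hn, and_self, if_true] at h4
  rw [← sum_mul, mul_eq_zero] at h4
  exact_mod_cast h4.resolve_right hD

lemma exists_odd_partial_fractions {m : ℕ} (hm : 2 ≤ m) : ∃ c : ℤ → ℕ → ℤ,
    ∑ j ∈ Icc (-m : ℤ) m, c j 1 = 0 ∧ (∀ l, Even l → ∑ j ∈ Icc (-m : ℤ) m, c j l = 0) ∧
    ∀ T : ℝ, (∀ j ∈ Icc (-m : ℤ) m, T + j ≠ 0) → (smoothDen m : ℝ) ^ 21 * ratFun m T =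
      gainFactor m * ∑ j ∈ Icc (-m : ℤ) m, ∑ l ∈ Icc 1 21, (c j l : ℝ) *
        (smoothDen m / (T + j)) ^ l := by
  obtain ⟨b, hb⟩ := exists_partial_fractions hm
  have hD : (smoothDen m : ℝ) ≠ 0 := by exact_mod_cast (smoothDen_pos m).ne'
  have hG : (gainFactor m : ℝ) ≠ 0 := by exact_mod_cast (gainFactor_pos m).ne'
  have hr : ∀ f : ℤ → ℝ, ∑ j ∈ Icc (-m : ℤ) m, f (-j) = ∑ j ∈ Icc (-m : ℤ) m, f j := by
    intro f
    refine sum_nbij' (fun i => -i) (fun i => -i) ?_ ?_ ?_ ?_ ?_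
    · intro i hi
      simp only [mem_Icc] at *
      omega
    · intro i hi
      simp only [mem_Icc] at *
      omega
    · simp
    · simp
    · simp
  have hr' : ∀ l, ∑ j ∈ Icc (-m : ℤ) m, b (-j) l = ∑ j ∈ Icc (-m : ℤ) m, b j l := by
    intro l
    have := hr fun j => (b j l : ℝ)
    exact_mod_cast this
  have hS : ∑ j ∈ Icc (-m : ℤ) m, b j 1 = 0 := by
    refine sum_residues_eq_zero hD (n := 21) (by norm_num) ?_
    have h := (tendsto_mul_ratFun m).const_mul ((smoothDen m : ℝ) ^ 21 / (2 * gainFactor m))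
    rw [mul_zero] at h
    refine h.congr' ?_
    filter_upwards [eventually_gt_atTop (m : ℝ)] with T hT
    have := hb T fun j hj => by
      rw [mem_Icc] at hj
      have : (-m : ℝ) ≤ j := by exact_mod_cast hj.1
      linarith
    rw [div_mul_eq_mul_div, mul_left_comm, this]
    field_simp
  refine ⟨fun j l => b j l - (-1) ^ l * b (-j) l, ?_, ?_, ?_⟩
  · rw [sum_sub_distrib, ← mul_sum, hr', hS]
    simp
  · intro l hl
    rw [sum_sub_distrib, ← mul_sum, hr', hl.neg_one_pow]
    simp
  · intro T hT
    have h1 := hb T hT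
    have h2 := hb (-T) fun j hj h => by
      refine hT (-j) ?_ ?_
      · simp only [mem_Icc] at *
        omega
      · push_cast
        linarith
    have h3 : ∑ j ∈ Icc (-m : ℤ) m, ∑ l ∈ Icc 1 21, (b j l : ℝ) * (smoothDen m / (-T + j)) ^ l =
        ∑ j ∈ Icc (-m : ℤ) m, ∑ l ∈ Icc 1 21, ((-1) ^ l * b (-j) l : ℝ) *
          (smoothDen m / (T + j)) ^ l := by
      rw [← hr]
      refine sum_congr rfl fun j _ => sum_congr rfl fun l _ => ?_
      have : (smoothDen m : ℝ) / (-T + (-j : ℤ)) = -1 * (smoothDen m / (T + j)) := by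
        push_cast
        rw [← neg_add, div_neg, neg_one_mul]
      rw [this, mul_pow]
      ring
    rw [ratFun_neg, h3] at h2
    push_cast
    simp only [sub_mul, sum_sub_distrib]
    linarith

lemma exists_int_eq_smoothDen_div_pow {m l : ℕ} {k : ℤ} (hk : k ≠ 0) (hkm : k.natAbs ≤ 2 * m) :
    ∃ n : ℤ, ((smoothDen m : ℝ) / k) ^ l = n := by
  have h : k ∣ (smoothDen m : ℤ) := Int.natAbs_dvd.1
    (by exact_mod_cast dvd_smoothDen (Int.natAbs_ne_zero.2 hk) hkm)
  obtain ⟨d, hd⟩ := h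
  have hk' : (k : ℝ) ≠ 0 := by exact_mod_cast hk
  refine ⟨d ^ l, ?_⟩
  have : (smoothDen m : ℝ) = k * d := by exact_mod_cast hd
  rw [this, mul_div_cancel_left₀ _ hk']
  push_cast
  rfl

lemma sum_Icc_two_twentyOne {g : ℕ → ℝ} (hg : ∀ l, Even l → g l = 0) (h3 : g 3 = 0) :
    ∑ l ∈ Icc 2 21, g l = ∑ k ∈ range 9, g (2 * k + 5) := by
  have h : ∑ k ∈ range 9, g (2 * k + 5) = ∑ l ∈ (range 9).image fun k => 2 * k + 5, g l := by
    rw [sum_image fun a _ b _ hab => by simpa using hab]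
  rw [h]
  symm
  refine sum_subset (by decide) fun l hl hl' => ?_
  rcases Nat.even_or_odd' l with ⟨k, rfl | rfl⟩
  · exact hg _ (even_two_mul k)
  · simp only [mem_Icc, mem_image, mem_range, not_exists, not_and] at hl hl'
    have := hl' (k - 2)
    obtain rfl : k = 1 := by omega
    exact h3

lemma exists_linear_form {m : ℕ} (hm : 2 ≤ m) : ∃ (w₀ : ℤ) (w : ℕ → ℤ),
    Tendsto (fun N : ℕ => ∑ t ∈ range N, (7 * ratFun m (t + m + 1) - ratFun m (t + 1 / 2))) atTop
      (𝓝 (gainFactor m / (smoothDen m : ℝ) ^ 21 *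
        (w₀ + ∑ k ∈ range 9, (w k : ℝ) * zetaR (2 * k + 5)))) := by
  obtain ⟨c, hc1, hc2, hc⟩ := exists_odd_partial_fractions hm
  set D := smoothDen m with hDdef
  have hD : (D : ℝ) ≠ 0 := by exact_mod_cast (smoothDen_pos m).ne'
  have hlim : ∀ x : ℝ, ∀ l ∈ Icc 1 21, ∀ j : ℤ,
      Tendsto (fun N : ℕ => ((D : ℝ) / ((((N : ℤ) + j : ℤ) : ℝ) + x)) ^ l) atTop (𝓝 0) := by
    intro x l hl j
    rw [mem_Icc] at hl
    have h : Tendsto (fun N : ℕ => (((N : ℤ) + j : ℤ) : ℝ) + x) atTop atTop := by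
      push_cast
      exact tendsto_atTop_add_const_right _ _ (tendsto_atTop_add_const_right _ _
        tendsto_natCast_atTop_atTop)
    have := (h.const_div_atTop (D : ℝ)).pow l
    rwa [zero_pow (by omega)] at this
  obtain ⟨e₁, he₁⟩ := tendsto_sum_partial_fractions (c := c) (n := 21) (a := -m) (b := m) (i := -m)
    (φ := fun l z => ((D : ℝ) / ((z : ℝ) + (m + 1))) ^ l) (Z := fun l => (D : ℝ) ^ l * zetaR l)
    (hlim _) (by
      intro l _ z hz1 hz2
      obtain ⟨n, hn⟩ := exists_int_eq_smoothDen_div_pow (m := m) (l := l) (k := z + m + 1)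
        (by omega) (by omega)
      refine ⟨n, ?_⟩
      rw [← hn]
      push_cast
      rw [add_assoc]) (by simp) hc1 (by
      intro l hl
      rw [mem_Icc] at hl
      refine ((hasSum_zetaR hl.1).mul_left ((D : ℝ) ^ l)).tendsto_sum_nat.congr fun N => ?_
      refine sum_congr rfl fun t _ => ?_
      rw [div_pow, mul_one_div]
      push_cast
      ring_nf)
  obtain ⟨e₂, he₂⟩ := tendsto_sum_partial_fractions (c := c) (n := 21) (a := -m) (b := m) (i := 0)
    (φ := fun l z => ((D : ℝ) / ((z : ℝ) + 1 / 2)) ^ l)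
    (Z := fun l => (D : ℝ) ^ l * ((2 ^ l - 1) * zetaR l))
    (hlim _) (by
      intro l _ z hz1 hz2
      obtain ⟨n, hn⟩ := exists_int_eq_smoothDen_div_pow (m := m) (l := l) (k := 2 * z + 1)
        (by omega) (by omega)
      refine ⟨2 ^ l * n, ?_⟩
      push_cast
      rw [← hn, ← mul_pow]
      congr 1
      push_cast
      rw [show (z : ℝ) + 1 / 2 = (2 * z + 1) / 2 by ring, div_div_eq_mul_div]
      ring) (by simp) hc1 (by
      intro l hl
      rw [mem_Icc] at hl
      refine ((hasSum_half_zetaR hl.1).mul_left ((D : ℝ) ^ l)).tendsto_sum_nat.congr fun N => ?_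
      refine sum_congr rfl fun t _ => ?_
      rw [div_pow, mul_one_div]
      push_cast
      ring_nf)
  set S : ℕ → ℤ := fun l => ∑ j ∈ Icc (-m : ℤ) m, c j l with hS
  refine ⟨7 * e₁ - e₂, fun k => S (2 * k + 5) * D ^ (2 * k + 5) * (8 - 2 ^ (2 * k + 5)), ?_⟩
  have h := ((he₁.const_mul 7).sub he₂).const_mul (gainFactor m / (D : ℝ) ^ 21)
  have hsum := sum_Icc_two_twentyOne
    (g := fun l => ((S l : ℤ) : ℝ) * (D : ℝ) ^ l * (8 - 2 ^ l) * zetaR l)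
    (fun l hl => by simp [hS, hc2 l hl]) (by norm_num)
  have hval : 7 * ((e₁ : ℝ) + ∑ l ∈ Icc 2 21, (S l : ℝ) * ((D : ℝ) ^ l * zetaR l)) -
      ((e₂ : ℝ) + ∑ l ∈ Icc 2 21, (S l : ℝ) * ((D : ℝ) ^ l * ((2 ^ l - 1) * zetaR l))) =
      ((7 * e₁ - e₂ : ℤ) : ℝ) + ∑ k ∈ range 9,
        ((S (2 * k + 5) * D ^ (2 * k + 5) * (8 - 2 ^ (2 * k + 5)) : ℤ) : ℝ) * zetaR (2 * k + 5) := by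
    push_cast at hsum ⊢
    rw [← hsum, mul_add, mul_sum, add_sub_add_comm, ← sum_sub_distrib]
    congr 1
    exact sum_congr rfl fun l _ => by ring
  rw [hval] at h
  refine h.congr fun N => ?_
  rw [mul_sum, ← sum_sub_distrib, mul_sum]
  refine sum_congr rfl fun t _ => ?_
  have h1 := hc (t + m + 1) fun j hj => by
    rw [mem_Icc] at hj
    have h1 : (-m : ℝ) ≤ j := by exact_mod_cast hj.1
    have h2 : (0 : ℝ) ≤ t := Nat.cast_nonneg t
    linarith
  have h2 := hc (t + 1 / 2) fun j _ h => by
    have : 2 * (t : ℤ) + 1 + 2 * j = 0 := by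
      have : 2 * (t : ℝ) + 1 + 2 * j = 0 := by linarith
      exact_mod_cast this
    omega
  have e1 : ∀ j : ℤ, (t : ℝ) + m + 1 + j = ((t + j : ℤ) : ℝ) + (m + 1) := fun j => by
    push_cast
    ring
  have e2 : ∀ j : ℤ, (t : ℝ) + 1 / 2 + j = ((t + j : ℤ) : ℝ) + 1 / 2 := fun j => by
    push_cast
    ring
  simp only [e1] at h1
  simp only [e2] at h2
  have hD' : (D : ℝ) ^ 21 ≠ 0 := pow_ne_zero _ hD
  rw [div_mul_eq_mul_div, div_eq_iff hD', mul_sub, mul_left_comm, ← h1, ← h2]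
  ring

end

section

open Finset

/-- The rising factorial `a (a + 1) ⋯ (a + n - 1)` of a real number. -/
noncomputable def risingFact (n : ℕ) (a : ℝ) : ℝ := ∏ i ∈ range n, (a + i)

lemma risingFact_pos (n : ℕ) {a : ℝ} (ha : 0 < a) : 0 < risingFact n a :=
  prod_pos fun i _ => by positivity

lemma risingFact_mul_sub_one (n : ℕ) (a : ℝ) :
    risingFact n a * (a - 1) = risingFact n (a - 1) * (a - 1 + n) := by
  have h1 := prod_range_succ (fun i : ℕ => a - 1 + i) n
  have h2 := prod_range_succ' (fun i : ℕ => a - 1 + i) n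
  rw [h1, Nat.cast_zero, add_zero] at h2
  unfold risingFact
  rw [h2]
  congr 1
  refine prod_congr rfl fun i _ => ?_
  push_cast
  ring

lemma risingFact_mul_le_sq (n : ℕ) {a : ℝ} (ha : 1 < a) :
    risingFact n a * risingFact n (a - 1) ≤ risingFact n (a - 1 / 2) ^ 2 := by
  unfold risingFact
  rw [← prod_mul_distrib, ← prod_pow]
  refine prod_le_prod (fun i _ => ?_) fun i _ => ?_
  · have : (0 : ℝ) ≤ i := Nat.cast_nonneg i
    exact mul_nonneg (by linarith) (by linarith)
  · nlinarith

lemma risingFact_sub_one_sq_le (n : ℕ) {a : ℝ} (ha : 4 ≤ a) :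
    risingFact n (a - 1) ^ 2 ≤ 3 / 2 * (risingFact n a * risingFact n (a - 2)) := by
  have h1 := risingFact_mul_sub_one n a
  have h2 := risingFact_mul_sub_one n (a - 1)
  rw [show a - 1 - 1 = a - 2 by ring] at h2
  have hn : (0 : ℝ) ≤ n := Nat.cast_nonneg n
  have p0 := risingFact_pos n (show 0 < a by linarith)
  have p2 := risingFact_pos n (show 0 < a - 2 by linarith)
  have hpos : 0 < (a - 1 + n) * (a - 2) := mul_pos (by linarith) (by linarith)
  have h3 : risingFact n (a - 1) ^ 2 * ((a - 1 + n) * (a - 2)) =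
      risingFact n a * risingFact n (a - 2) * ((a - 1) * (a - 2 + n)) := by
    linear_combination (-risingFact n (a - 1) * (a - 2)) * h1 + risingFact n a * (a - 1) * h2
  have h4 : (a - 1) * (a - 2 + n) ≤ 3 / 2 * ((a - 1 + n) * (a - 2)) := by nlinarith
  refine le_of_mul_le_mul_right ?_ hpos
  rw [h3]
  have := mul_le_mul_of_nonneg_left h4 (mul_pos p0 p2).le
  linarith

lemma prod_Icc_neg_eq_risingFact (n : ℕ) (x : ℝ) :
    ∏ i ∈ Icc (-n : ℤ) n, (x + i) = risingFact (2 * n + 1) (x - n) := by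
  unfold risingFact
  refine prod_nbij' (fun i => (i + n).toNat) (fun i => (i : ℤ) - n) ?_ ?_ ?_ ?_ ?_
  · intro i hi
    simp only [mem_Icc, mem_range] at *
    omega
  · intro i hi
    simp only [mem_Icc, mem_range] at *
    omega
  · intro i hi
    simp only [mem_Icc] at *
    omega
  · intro i hi
    simp
  · intro i hi
    rw [mem_Icc] at hi
    have : (((i + n).toNat : ℤ) : ℝ) = i + n := by
      rw [Int.toNat_of_nonneg (by omega)]
      push_cast
      rfl
    rw [Int.cast_natCast] at this
    rw [this]
    ring

lemma ratFun_eq (m : ℕ) (T : ℝ) : ratFun m T = ((2 * m).factorial : ℝ) ^ 14 *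
    risingFact (16 * m + 1) (2 * T - 8 * m) / risingFact (2 * m + 1) (T - m) ^ 22 := by
  have h1 := prod_Icc_neg_eq_risingFact (8 * m) (2 * T)
  have h2 := prod_Icc_neg_eq_risingFact m T
  push_cast at h1
  unfold ratFun
  rw [h1, h2, show 2 * (8 * m) + 1 = 16 * m + 1 by ring]

lemma ratFun_eq_zero {m : ℕ} {T : ℝ} {k : ℕ} (hk : k ≤ 8 * m) (hT : 2 * T = k) :
    ratFun m T = 0 := by
  unfold ratFun
  rw [prod_eq_zero (i := (-k : ℤ)) (by simp only [mem_Icc]; omega) (by rw [hT]; simp)]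
  simp

lemma ratFun_pos {m : ℕ} {T : ℝ} (hT : 4 * (m : ℝ) < T) : 0 < ratFun m T := by
  have hm : (0 : ℝ) ≤ m := Nat.cast_nonneg m
  rw [ratFun_eq]
  have h1 := risingFact_pos (16 * m + 1) (show 0 < 2 * T - 8 * m by linarith)
  have h2 := risingFact_pos (2 * m + 1) (show 0 < T - m by linarith)
  have h3 : (0 : ℝ) < (2 * m).factorial := by exact_mod_cast Nat.factorial_pos _
  positivity

lemma ratFun_sub_half_sq_le {m : ℕ} {T : ℝ} (hT : 4 * (m : ℝ) + 2 ≤ T) :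
    ratFun m (T - 1 / 2) ^ 2 ≤ 3 / 2 * (ratFun m T * ratFun m (T - 1)) := by
  have hm : (0 : ℝ) ≤ m := Nat.cast_nonneg m
  have h1 := risingFact_sub_one_sq_le (16 * m + 1) (show 4 ≤ 2 * T - 8 * m by linarith)
  have h2 := risingFact_mul_le_sq (2 * m + 1) (show 1 < T - m by linarith)
  have p1 := risingFact_pos (2 * m + 1) (show 0 < T - m by linarith)
  have p2 := risingFact_pos (2 * m + 1) (show 0 < T - m - 1 by linarith)
  have p3 := risingFact_pos (16 * m + 1) (show 0 < 2 * T - 8 * m by linarith)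
  have p4 := risingFact_pos (16 * m + 1) (show 0 < 2 * T - 8 * m - 2 by linarith)
  rw [ratFun_eq, ratFun_eq, ratFun_eq, show 2 * (T - 1 / 2) - 8 * (m : ℝ) = 2 * T - 8 * m - 1 by ring,
    show 2 * (T - 1) - 8 * (m : ℝ) = 2 * T - 8 * m - 2 by ring,
    show T - 1 / 2 - (m : ℝ) = T - m - 1 / 2 by ring, show T - 1 - (m : ℝ) = T - m - 1 by ring,
    div_mul_div_comm, ← mul_div_assoc, div_pow]
  refine div_le_div₀ (by positivity) ?_ (by positivity) ?_
  · rw [mul_pow]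
    have := mul_le_mul_of_nonneg_left h1 (show 0 ≤ (((2 * m).factorial : ℝ) ^ 14) ^ 2 by positivity)
    linarith
  · rw [← mul_pow, pow_right_comm]
    exact pow_le_pow_left₀ (by positivity) h2 22

lemma ratFun_sub_half_le {m : ℕ} {T : ℝ} (hT : 4 * (m : ℝ) + 2 ≤ T) :
    ratFun m (T - 1 / 2) ≤ 5 / 8 * (ratFun m T + ratFun m (T - 1)) := by
  have h := ratFun_sub_half_sq_le hT
  have p1 := ratFun_pos (show 4 * (m : ℝ) < T by linarith)
  have p2 := ratFun_pos (show 4 * (m : ℝ) < T - 1 by linarith)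
  refine le_of_sq_le_sq ?_ (by positivity)
  nlinarith [sq_nonneg (ratFun m T - ratFun m (T - 1)), mul_pos p1 p2]

lemma ratFun_four_mul_add_half_le {m : ℕ} (hm : 128 ≤ m) :
    ratFun m (4 * m + 1 / 2) ≤ ratFun m (4 * m + 1) := by
  have hm' : (128 : ℝ) ≤ m := by exact_mod_cast hm
  have h1 := risingFact_mul_sub_one (16 * m + 1) 2
  have h2 := risingFact_mul_sub_one (2 * m + 1) (3 * m + 1)
  have h3 := risingFact_mul_le_sq (2 * m + 1) (show 1 < 3 * (m : ℝ) + 1 by linarith)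
  rw [show (3 : ℝ) * m + 1 - 1 / 2 = 3 * m + 1 / 2 by ring] at h3
  have p1 := risingFact_pos (2 * m + 1) (show 0 < 3 * (m : ℝ) + 1 by linarith)
  have p2 := risingFact_pos (2 * m + 1) (show 0 < 3 * (m : ℝ) + 1 / 2 by linarith)
  have p3 := risingFact_pos (16 * m + 1) (show (0 : ℝ) < 2 by norm_num)
  have p4 := risingFact_pos (16 * m + 1) (show (0 : ℝ) < 1 by norm_num)
  have hC : (0 : ℝ) < (2 * m).factorial := by exact_mod_cast Nat.factorial_pos _
  rw [ratFun_eq, ratFun_eq, show 2 * (4 * (m : ℝ) + 1 / 2) - 8 * m = 1 by ring,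
    show 2 * (4 * (m : ℝ) + 1) - 8 * m = 2 by ring,
    show 4 * (m : ℝ) + 1 / 2 - m = 3 * m + 1 / 2 by ring,
    show 4 * (m : ℝ) + 1 - m = 3 * m + 1 by ring,
    div_le_div_iff₀ (by positivity) (by positivity), mul_assoc, mul_assoc]
  refine mul_le_mul_of_nonneg_left ?_ (by positivity)
  push_cast at h1 h2
  norm_num at h1
  rw [h1]
  set A := risingFact (2 * m + 1) (3 * m + 1)
  set B := risingFact (2 * m + 1) (3 * m + 1 / 2)
  have h4 : A ^ 2 ≤ 2 * B ^ 2 := by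
    have h5 : A ^ 2 * (3 * m) ≤ B ^ 2 * (5 * m + 1) := by
      have e : A ^ 2 * (3 * m) = A * risingFact (2 * m + 1) (3 * m + 1 - 1) * (5 * m + 1) := by
        linear_combination A * h2
      rw [e]
      exact mul_le_mul_of_nonneg_right h3 (by positivity)
    have h6 : B ^ 2 * (5 * m + 1) ≤ B ^ 2 * (2 * (3 * m)) :=
      mul_le_mul_of_nonneg_left (by linarith) (by positivity)
    refine le_of_mul_le_mul_right (a := 3 * (m : ℝ)) ?_ (by positivity)
    linarith
  have h7 : A ^ 22 ≤ 2048 * B ^ 22 := by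
    have := pow_le_pow_left₀ (by positivity) h4 11
    rw [mul_pow, ← pow_mul, ← pow_mul] at this
    norm_num at this
    exact this
  rw [mul_assoc]
  refine mul_le_mul_of_nonneg_left (h7.trans ?_) p4.le
  exact mul_le_mul_of_nonneg_right (by linarith) (by positivity)

lemma sum_ratFun_half_le {m : ℕ} (hm : 128 ≤ m) (N : ℕ) :
    ∑ k ∈ range N, ratFun m (4 * m + k + 1 / 2) ≤
      9 / 4 * ∑ k ∈ range N, ratFun m (4 * m + k + 1) := by
  have hpos : ∀ k : ℕ, 0 < ratFun m (4 * m + k + 1) := fun k => ratFun_pos (by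
    have : (0 : ℝ) ≤ k := Nat.cast_nonneg k
    linarith)
  have h : ∀ n : ℕ, ∑ k ∈ range (n + 1), ratFun m (4 * m + k + 1 / 2) ≤ ratFun m (4 * m + 1) +
      5 / 4 * ∑ k ∈ range (n + 1), ratFun m (4 * m + k + 1) -
        5 / 8 * ratFun m (4 * m + n + 1) := by
    intro n
    induction n with
    | zero =>
      have h0 := hpos 0
      simp only [zero_add, range_one, sum_singleton, Nat.cast_zero, add_zero] at h0 ⊢
      linarith [ratFun_four_mul_add_half_le hm]
    | succ n ih =>
      rw [sum_range_succ, sum_range_succ _ (n + 1)]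
      have hn : (0 : ℝ) ≤ n := Nat.cast_nonneg n
      have h1 := ratFun_sub_half_le (m := m) (T := 4 * m + n + 2) (by linarith)
      rw [show (4 : ℝ) * m + n + 2 - 1 / 2 = 4 * m + (n + 1 : ℕ) + 1 / 2 by push_cast; ring,
        show (4 : ℝ) * m + n + 2 - 1 = 4 * m + n + 1 by ring,
        show (4 : ℝ) * m + n + 2 = 4 * m + (n + 1 : ℕ) + 1 by push_cast; ring] at h1
      linarith
  cases N with
  | zero => simp
  | succ n =>
    have h1 := single_le_sum (f := fun k : ℕ => ratFun m (4 * m + k + 1)) (s := range (n + 1))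
      (fun k _ => (hpos k).le) (mem_range.2 (Nat.succ_pos n))
    simp only [Nat.cast_zero, add_zero] at h1
    linarith [h n, hpos n]

lemma sum_ratFun_difference (m N : ℕ) :
    ∑ t ∈ range (4 * m + N), (7 * ratFun m (t + m + 1) - ratFun m (t + 1 / 2)) =
      7 * ∑ k ∈ range (m + N), ratFun m (4 * m + k + 1) -
        ∑ k ∈ range N, ratFun m (4 * m + k + 1 / 2) := by
  rw [sum_sub_distrib, ← mul_sum]
  refine congrArg₂ (fun a b : ℝ => 7 * a - b) ?_ ?_
  · rw [show 4 * m + N = 3 * m + (m + N) by ring, sum_range_add, sum_eq_zero, zero_add]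
    · refine sum_congr rfl fun k _ => ?_
      push_cast
      ring_nf
    · intro t ht
      rw [mem_range] at ht
      exact ratFun_eq_zero (k := 2 * (t + m + 1)) (by omega) (by push_cast; ring)
  · rw [sum_range_add, sum_eq_zero, zero_add]
    · refine sum_congr rfl fun k _ => ?_
      push_cast
      ring_nf
    · intro t ht
      rw [mem_range] at ht
      exact ratFun_eq_zero (k := 2 * t + 1) (by omega) (by push_cast; ring)

lemma sum_ratFun_difference_bounds {m : ℕ} (hm : 128 ≤ m) (N : ℕ) (hN : 1 ≤ N) :
    ratFun m (4 * m + 1) ≤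
      ∑ t ∈ range (4 * m + N), (7 * ratFun m (t + m + 1) - ratFun m (t + 1 / 2)) ∧
    ∑ t ∈ range (4 * m + N), (7 * ratFun m (t + m + 1) - ratFun m (t + 1 / 2)) ≤
      7 * ∑ k ∈ range (m + N), ratFun m (4 * m + k + 1) := by
  have hpos : ∀ k : ℕ, 0 < ratFun m (4 * m + k + 1) := fun k => ratFun_pos (by
    have : (0 : ℝ) ≤ k := Nat.cast_nonneg k
    linarith)
  have hpos' : ∀ k : ℕ, 0 < ratFun m (4 * m + k + 1 / 2) := fun k => ratFun_pos (by
    have : (0 : ℝ) ≤ k := Nat.cast_nonneg k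
    linarith)
  rw [sum_ratFun_difference]
  constructor
  · have h1 := sum_ratFun_half_le hm N
    have h2 : ∑ k ∈ range N, ratFun m (4 * m + k + 1) ≤
        ∑ k ∈ range (m + N), ratFun m (4 * m + k + 1) :=
      sum_le_sum_of_subset_of_nonneg (range_mono (by omega)) fun k _ _ => (hpos k).le
    have h3 := single_le_sum (f := fun k : ℕ => ratFun m (4 * m + k + 1)) (s := range N)
      (fun k _ => (hpos k).le) (mem_range.2 hN)
    simp only [Nat.cast_zero, add_zero] at h3
    have h4 := hpos 0
    simp only [Nat.cast_zero, add_zero] at h4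
    linarith
  · have := sum_nonneg fun k (_ : k ∈ range N) => (hpos' k).le
    linarith

end

section

open Finset Real

lemma log_le_mul_log_sub {y : ℝ} (hy : 0 < y) :
    log y ≤ ((y + 1) * log (y + 1) - (y + 1)) - (y * log y - y) := by
  have h := one_sub_inv_le_log_of_pos (show 0 < (y + 1) / y by positivity)
  rw [log_div (by positivity) hy.ne', inv_div] at h
  have h2 : (y + 1) * (1 - y / (y + 1)) = 1 := by
    field_simp
    ring
  nlinarith [mul_le_mul_of_nonneg_left h (show 0 ≤ y + 1 by positivity)]

lemma mul_log_sub_le_log {y : ℝ} (hy : 0 < y) :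
    ((y + 1) * log (y + 1) - (y + 1)) - (y * log y - y) ≤ log (y + 1) := by
  have h := log_le_sub_one_of_pos (show 0 < (y + 1) / y by positivity)
  rw [log_div (by positivity) hy.ne'] at h
  have h2 : y * ((y + 1) / y - 1) = 1 := by
    field_simp
    ring
  nlinarith [mul_le_mul_of_nonneg_left h hy.le]

lemma log_risingFact (n : ℕ) {a : ℝ} (ha : 0 < a) :
    log (risingFact n a) = ∑ i ∈ range n, log (a + i) :=
  log_prod fun i _ => by positivity

lemma log_risingFact_le (n : ℕ) {a : ℝ} (ha : 0 < a) :
    log (risingFact (n + 1) a) ≤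
      log (a + n) + (((a + n) * log (a + n) - (a + n)) - (a * log a - a)) := by
  rw [log_risingFact _ ha, sum_range_succ, add_comm]
  refine add_le_add le_rfl ?_
  have h := sum_range_sub (fun i : ℕ => (a + i) * log (a + i) - (a + i)) n
  simp only [Nat.cast_zero, add_zero] at h
  rw [← h]
  refine sum_le_sum fun i _ => ?_
  have := log_le_mul_log_sub (show 0 < a + i by positivity)
  push_cast
  rwa [← add_assoc]

lemma le_log_risingFact (n : ℕ) {a : ℝ} (ha : 0 < a) :
    log a + (((a + n) * log (a + n) - (a + n)) - (a * log a - a)) ≤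
      log (risingFact (n + 1) a) := by
  rw [log_risingFact _ ha, sum_range_succ', Nat.cast_zero, add_zero, add_comm]
  refine add_le_add ?_ le_rfl
  have h := sum_range_sub (fun i : ℕ => (a + i) * log (a + i) - (a + i)) n
  simp only [Nat.cast_zero, add_zero] at h
  rw [← h]
  refine sum_le_sum fun i _ => ?_
  have := mul_log_sub_le_log (show 0 < a + i by positivity)
  push_cast
  rwa [← add_assoc]

lemma log_factorial_le {n : ℕ} (hn : 1 ≤ n) :
    log (n.factorial : ℝ) ≤ log n + (n * log n - n + 1) := by
  obtain ⟨k, rfl⟩ : ∃ k, n = k + 1 := ⟨n - 1, by omega⟩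
  have h := log_risingFact_le k one_pos
  have h1 : risingFact (k + 1) 1 = ((k + 1).factorial : ℝ) := by
    rw [← prod_range_add_one_eq_factorial]
    push_cast
    exact prod_congr rfl fun i _ => add_comm _ _
  rw [h1, log_one] at h
  push_cast
  rw [add_comm (k : ℝ) 1]
  linarith

/-- `∫_{x-c}^{x+c} (log t + 1) dt`. -/
noncomputable def logGap (c x : ℝ) : ℝ := (x + c) * log (x + c) - (x - c) * log (x - c)

lemma logGap_mul {c x s : ℝ} (hs : 0 < s) (hc : 0 ≤ c) (hx : c < x) :
    logGap (s * c) (s * x) = s * logGap c x + 2 * s * c * log s := by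
  unfold logGap
  rw [← mul_add, ← mul_sub, log_mul hs.ne' (by linarith), log_mul hs.ne' (by linarith)]
  ring

lemma hasDerivAt_logGap {c x : ℝ} (hc : 0 ≤ c) (hx : c < x) :
    HasDerivAt (logGap c) (log (x + c) - log (x - c)) x := by
  have h1 := (hasDerivAt_mul_log (show x + c ≠ 0 by linarith)).comp x ((hasDerivAt_id x).add_const c)
  have h2 := (hasDerivAt_mul_log (show x - c ≠ 0 by linarith)).comp x ((hasDerivAt_id x).sub_const c)
  have h3 := h1.sub h2
  rw [show (log (x + c) + 1) * 1 - (log (x - c) + 1) * 1 = log (x + c) - log (x - c) by ring] at h3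
  exact h3

lemma logGap_le_logGap {c x y : ℝ} (hc : 0 ≤ c) (hx : c < x) (hxy : x ≤ y) :
    logGap c x ≤ logGap c y := by
  have h : MonotoneOn (logGap c) (Set.Ioi c) := by
    refine monotoneOn_of_hasDerivWithinAt_nonneg (f' := fun x => log (x + c) - log (x - c))
      (convex_Ioi c) ?_ ?_ ?_
    · exact fun z hz => (hasDerivAt_logGap hc hz).continuousAt.continuousWithinAt
    · intro z hz
      rw [interior_Ioi] at hz
      exact (hasDerivAt_logGap hc hz).hasDerivWithinAt
    · intro z hz
      rw [interior_Ioi, Set.mem_Ioi] at hz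
      exact sub_nonneg.2 (log_le_log (by linarith) (by linarith))
  exact h hx (lt_of_lt_of_le hx hxy) hxy

/-- The exponential growth rate of `ratFun m (m * x)`. -/
noncomputable def ratFunRate (x : ℝ) : ℝ := 44 * log 2 + 2 * logGap 4 x - 22 * logGap 1 x

lemma four_add_mul_sub_pow_le {x : ℝ} (hx : 129 / 32 ≤ x) :
    (x + 4) * (x - 1) ^ 11 ≤ (x - 4) * (x + 1) ^ 11 := by
  have hz : 0 ≤ x ^ 2 - 65 / 4 := by nlinarith
  set z := x ^ 2 - 65 / 4 with hzdef
  have h : (x - 4) * (x + 1) ^ 11 - (x + 4) * (x - 1) ^ 11 = 2 * x * (7 * z ^ 5 + 2055 / 4 * z ^ 4 +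
      112411 / 8 * z ^ 3 + 5436319 / 32 * z ^ 2 + 196314835 / 256 * z + 4266443 / 1024) := by
    rw [hzdef]
    ring
  have : 0 ≤ (x - 4) * (x + 1) ^ 11 - (x + 4) * (x - 1) ^ 11 := by
    rw [h]
    have : 0 ≤ x := by linarith
    positivity
  linarith

lemma ratFunRate_antitoneOn : AntitoneOn ratFunRate (Set.Ici (129 / 32)) := by
  have hd : ∀ x : ℝ, 129 / 32 ≤ x → HasDerivAt ratFunRate
      (2 * (log (x + 4) - log (x - 4)) - 22 * (log (x + 1) - log (x - 1))) x := fun x hx =>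
    (((hasDerivAt_logGap (c := 4) (by norm_num) (by linarith)).const_mul 2).const_add _).sub
      ((hasDerivAt_logGap (c := 1) (by norm_num) (by linarith)).const_mul 22)
  refine antitoneOn_of_hasDerivWithinAt_nonpos (f' := fun x =>
    2 * (log (x + 4) - log (x - 4)) - 22 * (log (x + 1) - log (x - 1))) (convex_Ici _) ?_ ?_ ?_
  · exact fun z hz => (hd z hz).continuousAt.continuousWithinAt
  · intro z hz
    exact (hd z (interior_subset hz)).hasDerivWithinAt
  · intro z hz
    have hz' : 129 / 32 ≤ z := interior_subset hz
    have p1 : 0 < z - 4 := by linarith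
    have p2 : 0 < z + 4 := by linarith
    have p3 : 0 < z - 1 := by linarith
    have p4 : 0 < z + 1 := by linarith
    have h := log_le_log (by positivity) (four_add_mul_sub_pow_le hz')
    rw [log_mul p2.ne' (by positivity), log_mul p1.ne' (by positivity), log_pow, log_pow] at h
    push_cast at h
    linarith

set_option exponentiation.threshold 1000 in
lemma log_five_bound : 603 / 4 * log 2 ≤ 22 * (5 * log 5 - 3 * log 3) := by
  have h : (2 : ℝ) ^ 603 * 3 ^ 264 ≤ 5 ^ 440 := by norm_num
  have h1 := log_le_log (by positivity) h
  rw [log_mul (by positivity) (by positivity), log_pow, log_pow, log_pow] at h1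
  push_cast at h1
  linarith

lemma ratFunRate_le {x : ℝ} (hx : 4 < x) : ratFunRate x ≤ -(4031 / 100) := by
  have h4 : logGap 4 (129 / 32) ≤ 257 / 32 * (3 * log 2 + 1 / 256) + 5 / 32 * log 2 := by
    unfold logGap
    have e1 : log ((129 : ℝ) / 32 + 4) ≤ 3 * log 2 + 1 / 256 := by
      have : (129 : ℝ) / 32 + 4 = 2 ^ 3 * (257 / 256) := by norm_num
      rw [this, log_mul (by norm_num) (by norm_num), log_pow]
      have := log_le_sub_one_of_pos (show (0 : ℝ) < 257 / 256 by norm_num)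
      push_cast
      linarith
    have e2 : log ((129 : ℝ) / 32 - 4) = -(5 * log 2) := by
      have : (129 : ℝ) / 32 - 4 = (2 ^ 5)⁻¹ := by norm_num
      rw [this, log_inv, log_pow]
      norm_num
    rw [e2]
    linarith
  have h1 : logGap 1 4 = 5 * log 5 - 3 * log 3 := by
    unfold logGap
    norm_num
  have h5 := log_five_bound
  have h2 := log_two_gt_d9
  have key : 44 * log 2 + 2 * logGap 4 (129 / 32) - 22 * logGap 1 4 ≤ -(4031 / 100) := by
    rw [h1]
    linarith
  rcases le_total x (129 / 32) with h | h
  · have a1 := logGap_le_logGap (c := 4) (by norm_num) hx h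
    have a2 := logGap_le_logGap (c := 1) (by norm_num) (by norm_num) hx.le
    unfold ratFunRate
    linarith
  · have a1 := ratFunRate_antitoneOn (Set.mem_Ici.2 le_rfl) h h
    have a2 := logGap_le_logGap (c := 1) (x := 4) (y := 129 / 32) (by norm_num) (by norm_num)
      (by norm_num)
    unfold ratFunRate at a1 ⊢
    linarith

lemma log_ratFun_le {m : ℕ} (hm : 1 ≤ m) {T : ℝ} (hT : 4 * (m : ℝ) < T) :
    log (ratFun m T) ≤ m * ratFunRate (T / m) + 14 * log (2 * m) + 14 + log (2 * T + 8 * m) -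
      22 * log (T - m) := by
  have hm' : (1 : ℝ) ≤ m := by exact_mod_cast hm
  have p1 := risingFact_pos (16 * m + 1) (show 0 < 2 * T - 8 * m by linarith)
  have p2 := risingFact_pos (2 * m + 1) (show 0 < T - m by linarith)
  have p3 : (0 : ℝ) < (2 * m).factorial := by exact_mod_cast Nat.factorial_pos _
  rw [ratFun_eq, log_div (by positivity) (by positivity), log_mul (by positivity) p1.ne', log_pow,
    log_pow]
  have h1 := log_risingFact_le (16 * m) (show 0 < 2 * T - 8 * m by linarith)
  have h2 := le_log_risingFact (2 * m) (show 0 < T - m by linarith)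
  have h3 := log_factorial_le (show 1 ≤ 2 * m by omega)
  push_cast at h1 h2 h3 ⊢
  rw [show 2 * T - 8 * (m : ℝ) + 16 * m = 2 * T + 8 * m by ring] at h1
  rw [show T - (m : ℝ) + 2 * m = T + m by ring] at h2
  have hx : 4 < T / m := by
    rw [lt_div_iff₀ (by linarith)]
    exact hT
  have e : (m : ℝ) * (T / m) = T := by field_simp
  have g1 := logGap_mul (c := 4) (x := T / m) (s := 2 * m) (by linarith) (by norm_num) hx
  have g2 := logGap_mul (c := 1) (x := T / m) (s := m) (by linarith) (by norm_num) (by linarith)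
  rw [show 2 * (m : ℝ) * 4 = 8 * m by ring, mul_assoc 2 (m : ℝ) (T / m), e] at g1
  rw [mul_one, e] at g2
  have hl : log (2 * (m : ℝ)) = log 2 + log m := log_mul (by norm_num) (by linarith)
  unfold logGap at g1 g2
  unfold ratFunRate logGap
  rw [hl] at g1 h3 ⊢
  nlinarith

lemma ratFun_le {m : ℕ} (hm : 1 ≤ m) {T : ℝ} (hT : 4 * (m : ℝ) < T) :
    ratFun m T ≤ exp (14 + 24 * log 2 - 4031 / 100 * m) / T ^ 2 := by
  have hm' : (1 : ℝ) ≤ m := by exact_mod_cast hm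
  have hT0 : 0 < T := by linarith
  have h := log_ratFun_le hm hT
  have hr := mul_le_mul_of_nonneg_left (ratFunRate_le (x := T / m) (by
    rw [lt_div_iff₀ (by linarith)]
    exact hT)) (show (0 : ℝ) ≤ m by linarith)
  have h1 : log (2 * m) ≤ log T := log_le_log (by linarith) (by linarith)
  have h2 : log (2 * T + 8 * m) ≤ 2 * log 2 + log T := by
    refine (log_le_log (by linarith) (show 2 * T + 8 * m ≤ 2 ^ 2 * T by linarith)).trans ?_
    rw [log_mul (by norm_num) hT0.ne', log_pow]
    push_cast
    rfl
  have h3 : log T - log 2 ≤ log (T - m) := by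
    rw [← log_div hT0.ne' (by norm_num)]
    exact log_le_log (by linarith) (by linarith)
  have h4 : 0 ≤ log T := log_nonneg (by linarith)
  rw [le_div_iff₀ (by positivity), ← log_le_log_iff (mul_pos (ratFun_pos hT) (by positivity))
    (exp_pos _), log_exp, log_mul (ratFun_pos hT).ne' (by positivity), log_pow]
  push_cast
  linarith

lemma sum_inv_sq_le_one {m : ℕ} (hm : 1 ≤ m) (N : ℕ) :
    ∑ k ∈ range N, 1 / ((4 * m + k + 1 : ℝ)) ^ 2 ≤ 1 := by
  have hm' : (1 : ℝ) ≤ m := by exact_mod_cast hm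
  have h : ∑ k ∈ range N, 1 / ((4 * m + k + 1 : ℝ)) ^ 2 ≤
      1 / (4 * (m : ℝ)) - 1 / (4 * (m : ℝ) + N) := by
    have := sum_range_sub' (fun i : ℕ => 1 / (4 * (m : ℝ) + i)) N
    rw [Nat.cast_zero, add_zero] at this
    rw [← this]
    refine sum_le_sum fun k _ => ?_
    have hk : (0 : ℝ) ≤ k := Nat.cast_nonneg k
    push_cast
    rw [← add_assoc, div_sub_div _ _ (by positivity) (by positivity),
      div_le_div_iff₀ (by positivity) (by positivity)]
    nlinarith
  have h1 : 1 / (4 * (m : ℝ)) ≤ 1 := by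
    rw [div_le_one (by linarith)]
    linarith
  have h2 : 0 ≤ 1 / (4 * (m : ℝ) + N) := by positivity
  linarith

lemma sum_ratFun_le {m : ℕ} (hm : 1 ≤ m) (N : ℕ) :
    ∑ k ∈ range N, ratFun m (4 * m + k + 1) ≤ exp (14 + 24 * log 2 - 4031 / 100 * m) := by
  have h : ∑ k ∈ range N, ratFun m (4 * m + k + 1) ≤ ∑ k ∈ range N,
      exp (14 + 24 * log 2 - 4031 / 100 * m) * (1 / ((4 * m + k + 1 : ℝ)) ^ 2) := by
    refine sum_le_sum fun k _ => ?_
    rw [mul_one_div]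
    refine ratFun_le hm ?_
    have hk : (0 : ℝ) ≤ k := Nat.cast_nonneg k
    linarith
  rw [← mul_sum] at h
  refine h.trans ?_
  have := mul_le_mul_of_nonneg_left (sum_inv_sq_le_one hm N)
    (exp_pos (14 + 24 * log 2 - 4031 / 100 * m)).le
  linarith

end

section

open Finset Real Filter Topology

lemma theta_natCast (n : ℕ) :
    Chebyshev.theta n = ∑ p ∈ Ioc 0 n with p.Prime, log (p : ℝ) := by
  rw [Chebyshev.theta, Nat.floor_natCast]

lemma natLog_mul_log_le {n p : ℕ} (hn : n ≠ 0) (hp : p.Prime) :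
    (Nat.log p n : ℝ) * log p ≤ log p + if p ≤ Nat.sqrt n then log n else 0 := by
  have h0 : 0 ≤ log (p : ℝ) := log_nonneg (by exact_mod_cast hp.one_lt.le)
  split_ifs with h
  · have h1 : ((p ^ Nat.log p n : ℕ) : ℝ) ≤ n := by exact_mod_cast Nat.pow_log_le_self p hn
    have h2 := log_le_log (by exact_mod_cast pow_pos hp.pos _) h1
    rw [Nat.cast_pow, log_pow] at h2
    linarith
  · have h1 : Nat.log p n < 2 := by
      refine Nat.log_lt_of_lt_pow hn ?_
      rw [pow_two]
      exact Nat.sqrt_lt.1 (not_le.1 h)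
    have h2 : (Nat.log p n : ℝ) ≤ 1 := by exact_mod_cast Nat.lt_succ_iff.1 h1
    rw [add_zero]
    exact mul_le_of_le_one_left h0 h2

lemma log_smoothDen_le {m : ℕ} (hm : 1 ≤ m) : log (smoothDen m) ≤
    Chebyshev.theta ((2 * m : ℕ) : ℝ) + √(10 * m) * log (10 * m) := by
  have hl : 0 ≤ log (10 * m : ℝ) := log_nonneg (by
    have : (1 : ℝ) ≤ m := by exact_mod_cast hm
    linarith)
  have h1 : log (smoothDen m) =
      ∑ p ∈ Ioc 0 (2 * m) with p.Prime, (Nat.log p (10 * m) : ℝ) * log p := by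
    unfold smoothDen
    rw [Nat.cast_prod, log_prod fun p hp => by
      have := (mem_filter.1 hp).2.pos
      positivity]
    exact sum_congr rfl fun p _ => by rw [Nat.cast_pow, log_pow]
  have h2 : log (smoothDen m) ≤ ∑ p ∈ Ioc 0 (2 * m) with p.Prime,
      (log (p : ℝ) + if p ≤ Nat.sqrt (10 * m) then log ((10 * m : ℕ) : ℝ) else 0) := by
    rw [h1]
    exact sum_le_sum fun p hp => natLog_mul_log_le (by omega) (mem_filter.1 hp).2
  rw [sum_add_distrib, ← theta_natCast, ← sum_filter, sum_const, nsmul_eq_mul] at h2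
  refine h2.trans (add_le_add le_rfl ?_)
  push_cast
  refine mul_le_mul_of_nonneg_right ?_ hl
  have h3 : #{p ∈ {p ∈ Ioc 0 (2 * m) | p.Prime} | p ≤ Nat.sqrt (10 * m)} ≤ Nat.sqrt (10 * m) := by
    have := card_le_card (show {p ∈ {p ∈ Ioc 0 (2 * m) | p.Prime} | p ≤ Nat.sqrt (10 * m)} ⊆
      Ioc 0 (Nat.sqrt (10 * m)) from fun p hp => by
        simp only [mem_filter, mem_Ioc] at *
        omega)
    simpa using this
  have h4 := Real.nat_sqrt_le_real_sqrt (a := 10 * m)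
  push_cast at h4
  exact le_trans (by exact_mod_cast h3) h4

lemma le_log_gainFactor (m : ℕ) :
    ∑ i ∈ Icc 2 7, (Chebyshev.theta ((16 * m / (8 + i) : ℕ) : ℝ) - Chebyshev.theta (m : ℝ)) ≤
      log (gainFactor m) := by
  have h1 : log (gainFactor m) =
      ∑ p ∈ Ioc m (2 * m) with p.Prime, ((16 * m / p - 9 : ℕ) : ℝ) * log p := by
    unfold gainFactor
    rw [Nat.cast_prod, log_prod fun p hp => by
      have := (mem_filter.1 hp).2.pos
      positivity]
    exact sum_congr rfl fun p _ => by rw [Nat.cast_pow, log_pow]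
  have h2 : ∀ i ∈ Icc 2 7, Chebyshev.theta ((16 * m / (8 + i) : ℕ) : ℝ) - Chebyshev.theta (m : ℝ) =
      ∑ p ∈ Ioc m (2 * m) with p.Prime, if p ≤ 16 * m / (8 + i) then log (p : ℝ) else 0 := by
    intro i hi
    rw [mem_Icc] at hi
    have ha : m ≤ 16 * m / (8 + i) := by
      rw [Nat.le_div_iff_mul_le (by omega)]
      nlinarith
    have hb : 16 * m / (8 + i) ≤ 2 * m := by
      refine Nat.div_le_of_le_mul ?_
      nlinarith
    rw [theta_natCast, theta_natCast, sub_eq_iff_eq_add, ← sum_filter, ← sum_union]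
    · refine sum_congr ?_ fun _ _ => rfl
      ext p
      simp only [mem_union, mem_filter, mem_Ioc]
      constructor
      · rintro ⟨h1, h2⟩
        by_cases h : p ≤ m
        · exact Or.inr ⟨⟨h1.1, h⟩, h2⟩
        · exact Or.inl ⟨⟨⟨by omega, by omega⟩, h2⟩, h1.2⟩
      · rintro (⟨⟨h1, h2⟩, h3⟩ | ⟨h1, h2⟩)
        · exact ⟨⟨by omega, h3⟩, h2⟩
        · exact ⟨⟨h1.1, by omega⟩, h2⟩
    · refine disjoint_left.2 fun p hp hp' => ?_
      simp only [mem_filter, mem_Ioc] at hp hp'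
      omega
  rw [sum_congr rfl h2, sum_comm, h1]
  refine sum_le_sum fun p hp => ?_
  have hp : p.Prime := (mem_filter.1 hp).2
  have h0 : 0 ≤ log (p : ℝ) := log_nonneg (by exact_mod_cast hp.one_lt.le)
  rw [← sum_filter, sum_const, nsmul_eq_mul]
  refine mul_le_mul_of_nonneg_right ?_ h0
  have h3 := card_le_card (show {i ∈ Icc 2 7 | p ≤ 16 * m / (8 + i)} ⊆
    Icc 2 (16 * m / p - 8) from fun i hi => by
      simp only [mem_filter, mem_Icc] at hi ⊢
      have := hi.2
      rw [Nat.le_div_iff_mul_le (by omega), mul_comm, ← Nat.le_div_iff_mul_le hp.pos] at this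
      omega)
  rw [Nat.card_Icc] at h3
  exact_mod_cast h3.trans (by omega)

lemma tendsto_theta_mul_div {a : ℝ} (ha : 0 < a) :
    Tendsto (fun m : ℕ => Chebyshev.theta (a * m) / m) atTop (𝓝 a) := by
  have h := (tendsto_theta_div.comp
    ((tendsto_natCast_atTop_atTop (R := ℝ)).const_mul_atTop ha)).const_mul a
  rw [mul_one] at h
  refine h.congr fun m => ?_
  rw [Function.comp_apply]
  field_simp

lemma tendsto_sqrt_mul_log_div :
    Tendsto (fun m : ℕ => √(10 * m) * log (10 * m) / m) atTop (𝓝 0) := by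
  have h := ((isLittleO_log_rpow_atTop (r := 1 / 2) (by norm_num)).tendsto_div_nhds_zero.comp
    ((tendsto_natCast_atTop_atTop (R := ℝ)).const_mul_atTop (show (0 : ℝ) < 10 by norm_num))).const_mul
    10
  rw [mul_zero] at h
  refine h.congr' ?_
  filter_upwards [eventually_ge_atTop 1] with m hm
  have hm' : (1 : ℝ) ≤ m := by exact_mod_cast hm
  rw [Function.comp_apply, ← sqrt_eq_rpow]
  have h1 : 0 < √(10 * (m : ℝ)) := sqrt_pos.2 (by linarith)
  have h2 : √(10 * (m : ℝ)) * √(10 * (m : ℝ)) = 10 * m := mul_self_sqrt (by linarith)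
  rw [mul_div_assoc', div_eq_div_iff h1.ne' (by linarith)]
  linear_combination (-log (10 * (m : ℝ))) * h2

lemma eventually_log_smoothDen_sub_log_gainFactor_le :
    ∀ᶠ m : ℕ in atTop, 21 * log (smoothDen m) - log (gainFactor m) ≤ 402 / 10 * m := by
  have h1 := (tendsto_theta_mul_div (a := 2) (by norm_num)).add tendsto_sqrt_mul_log_div
  have h2 : Tendsto (fun m : ℕ => ∑ i ∈ Icc 2 7,
      (Chebyshev.theta ((16 / (8 + i : ℕ) : ℝ) * m) / m - Chebyshev.theta (1 * m) / m)) atTop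
      (𝓝 (∑ i ∈ Icc 2 7, ((16 / (8 + i : ℕ) : ℝ) - 1))) :=
    tendsto_finsetSum _ fun i _ => (tendsto_theta_mul_div (by positivity)).sub
      (tendsto_theta_mul_div one_pos)
  have h3 := (h1.const_mul 21).sub h2
  have hlt : 21 * (2 + 0) - ∑ i ∈ Icc 2 7, ((16 / (8 + i : ℕ) : ℝ) - 1) < 402 / 10 := by
    norm_num [sum_Icc_succ_top]
  filter_upwards [h3.eventually (gt_mem_nhds hlt), eventually_ge_atTop 1] with m hm hm1
  have hm' : (0 : ℝ) < m := by exact_mod_cast hm1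
  have h4 := log_smoothDen_le hm1
  have h5 := le_log_gainFactor m
  have h6 : ∀ i, Chebyshev.theta ((16 * m / (8 + i) : ℕ) : ℝ) =
      Chebyshev.theta ((16 / (8 + i : ℕ) : ℝ) * m) := fun i => by
    rw [Chebyshev.theta_eq_theta_coe_floor (_ * _), div_mul_eq_mul_div,
      show (16 : ℝ) * m = ((16 * m : ℕ) : ℝ) by push_cast; rfl, Nat.floor_div_eq_div]
  simp only [h6] at h5
  push_cast at h4
  simp only [one_mul, ← sub_div] at hm
  rw [← sum_div, ← add_div, ← mul_div_assoc, ← sub_div, div_lt_iff₀ hm'] at hm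
  linarith

lemma linear_form_bounds {m : ℕ} (hm : 128 ≤ m) : ∃ (w₀ : ℤ) (w : ℕ → ℤ),
    0 < (w₀ + ∑ k ∈ range 9, (w k : ℝ) * zetaR (2 * k + 5)) ∧
    (w₀ + ∑ k ∈ range 9, (w k : ℝ) * zetaR (2 * k + 5)) ≤
      7 * exp (14 + 24 * log 2 + (21 * log (smoothDen m) - log (gainFactor m) - 4031 / 100 * m)) := by
  obtain ⟨w₀, w, hw⟩ := exists_linear_form (show 2 ≤ m by omega)
  refine ⟨w₀, w, ?_⟩
  set L := w₀ + ∑ k ∈ range 9, (w k : ℝ) * zetaR (2 * k + 5)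
  have hD : (0 : ℝ) < smoothDen m := by exact_mod_cast smoothDen_pos m
  have hG : (0 : ℝ) < gainFactor m := by exact_mod_cast gainFactor_pos m
  have hw' := hw.comp (tendsto_add_atTop_nat (4 * m))
  have hlow : ratFun m (4 * m + 1) ≤ gainFactor m / (smoothDen m : ℝ) ^ 21 * L := by
    refine ge_of_tendsto hw' ?_
    filter_upwards [eventually_ge_atTop 1] with N hN
    rw [Function.comp_apply, add_comm N]
    exact (sum_ratFun_difference_bounds hm N hN).1
  have hup : gainFactor m / (smoothDen m : ℝ) ^ 21 * L ≤
      7 * exp (14 + 24 * log 2 - 4031 / 100 * m) := by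
    refine le_of_tendsto hw' ?_
    filter_upwards [eventually_ge_atTop 1] with N hN
    rw [Function.comp_apply, add_comm N]
    refine (sum_ratFun_difference_bounds hm N hN).2.trans ?_
    exact mul_le_mul_of_nonneg_left (sum_ratFun_le (by omega) _) (by norm_num)
  constructor
  · have h := (ratFun_pos (show 4 * (m : ℝ) < 4 * m + 1 by linarith)).trans_le hlow
    exact pos_of_mul_pos_right h (by positivity)
  · have he : exp (14 + 24 * log 2 + (21 * log (smoothDen m) - log (gainFactor m) -
        4031 / 100 * m)) = (smoothDen m : ℝ) ^ 21 / gainFactor m *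
          exp (14 + 24 * log 2 - 4031 / 100 * m) := by
      rw [show 14 + 24 * log 2 + (21 * log (smoothDen m) - log (gainFactor m) - 4031 / 100 * m) =
        21 * log (smoothDen m) - log (gainFactor m) + (14 + 24 * log 2 - 4031 / 100 * m) by ring,
        exp_add, exp_sub, exp_log hG, show (21 : ℝ) = (21 : ℕ) by norm_num, ← log_pow,
        exp_log (by positivity)]
    rw [he]
    rw [div_mul_eq_mul_div, div_le_iff₀ (by positivity)] at hup
    rw [div_mul_eq_mul_div, mul_div_assoc', le_div_iff₀ hG]
    linarith

lemma exists_common_denominator {z : ℕ → ℝ} {s : Finset ℕ} (h : ∀ k ∈ s, ¬ Irrational (z k)) :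
    ∃ q : ℕ, 0 < q ∧ ∀ k ∈ s, ∃ n : ℤ, q * z k = n := by
  have h1 : ∀ k, ∃ r : ℚ, k ∈ s → (r : ℝ) = z k := fun k => by
    by_cases hk : k ∈ s
    · obtain ⟨r, hr⟩ := not_not.1 (h k hk)
      exact ⟨r, fun _ => hr⟩
    · exact ⟨0, fun h => absurd h hk⟩
  choose r hr using h1
  refine ⟨∏ k ∈ s, (r k).den, prod_pos fun k _ => (r k).den_pos, fun k hk => ?_⟩
  obtain ⟨d, hd⟩ := dvd_prod_of_mem (fun k => (r k).den) hk
  refine ⟨d * (r k).num, ?_⟩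
  have h2 : ((r k).den : ℝ) * (r k : ℝ) = (r k).num := by
    exact_mod_cast Rat.den_mul_eq_num (r k)
  rw [hd, ← hr k hk]
  push_cast
  linear_combination (d : ℝ) * h2

lemma exists_irrational_zetaR : ∃ k ∈ range 9, Irrational (zetaR (2 * k + 5)) := by
  by_contra! h
  obtain ⟨q, hq, hz⟩ := exists_common_denominator h
  have hq' : (0 : ℝ) < q := by exact_mod_cast hq
  have hlim : Tendsto (fun m : ℕ => q * (7 * exp (14 + 24 * log 2 + -(11 / 100) * m))) atTop
      (𝓝 0) := by
    have h1 : Tendsto (fun m : ℕ => 14 + 24 * log 2 + -(11 / 100 : ℝ) * m) atTop atBot :=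
      tendsto_atBot_add_const_left _ _
        ((tendsto_natCast_atTop_atTop (R := ℝ)).const_mul_atTop_of_neg (by norm_num))
    have := ((tendsto_exp_atBot.comp h1).const_mul 7).const_mul (q : ℝ)
    rwa [mul_zero, mul_zero] at this
  obtain ⟨m, hm1, hm2, hm3⟩ := ((hlim.eventually (gt_mem_nhds one_pos)).and
    ((eventually_ge_atTop 128).and eventually_log_smoothDen_sub_log_gainFactor_le)).exists
  obtain ⟨w₀, w, hpos, hle⟩ := linear_form_bounds hm2
  have hInt : ∃ n : ℤ, q * (w₀ + ∑ k ∈ range 9, (w k : ℝ) * zetaR (2 * k + 5)) = n := by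
    have h1 : ∀ k, ∃ n : ℤ, k ∈ range 9 → q * zetaR (2 * k + 5) = n := fun k => by
      by_cases hk : k ∈ range 9
      · exact (hz k hk).imp fun n hn _ => hn
      · exact ⟨0, fun h => absurd h hk⟩
    choose n hn using h1
    refine ⟨q * w₀ + ∑ k ∈ range 9, w k * n k, ?_⟩
    push_cast
    rw [mul_add, mul_sum]
    congr 1
    exact sum_congr rfl fun k hk => by rw [← hn k hk]; ring
  obtain ⟨n, hn⟩ := hInt
  have hn0 : 0 < n := by
    have := mul_pos hq' hpos
    rw [hn] at this
    exact_mod_cast this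
  have hn1 : (1 : ℝ) ≤ n := by exact_mod_cast hn0
  have h2 := mul_le_mul_of_nonneg_left (hle.trans (mul_le_mul_of_nonneg_left
    (exp_le_exp.2 (show 14 + 24 * log 2 + (21 * log (smoothDen m) - log (gainFactor m) -
      4031 / 100 * m) ≤ 14 + 24 * log 2 + -(11 / 100) * m by linarith)) (by norm_num))) hq'.le
  rw [hn] at h2
  linarith

end

/-- (Rivoal) At least one of the nine numbers
`ζ(5), ζ(7), ζ(9), ζ(11), ζ(13), ζ(15), ζ(17), ζ(19), ζ(21)` is irrational. -/
theorem rivoal_one_of_nine_irrational :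
    Irrational (zetaR 5) ∨ Irrational (zetaR 7) ∨ Irrational (zetaR 9) ∨
    Irrational (zetaR 11) ∨ Irrational (zetaR 13) ∨ Irrational (zetaR 15) ∨
    Irrational (zetaR 17) ∨ Irrational (zetaR 19) ∨ Irrational (zetaR 21) := by
  obtain ⟨k, hk, h⟩ := exists_irrational_zetaR
  rw [Finset.mem_range] at hk
  interval_cases k <;> simp_all
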